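/- Let K be an algebraically closed field of characteristic not equal to 2. The bound quiver algebras D₁, D₂, D₃, D₄ are all τ-tilting finite: D₁ has exactly 2 isomorphism classes of basic support τ-tilting modules, while D₂, D₃ and D₄ each have exactly 6, with Hasse quiver of type H_{2,2}. Consequently, every representation-infinite tame block algebra of a Hecke algebra of classical type over K (each such block being Morita equivalent to one of D₁–D₄ by Ariki's classification) is τ-tilting finite. -/

import Mathlib

/-!
Core definitions for τ-tilting theory of finite dimensional algebras.

Throughout, for an algebra `Λ`, *right* `Λ`-modules are formalized as left modules
over the opposite ring `Λᵐᵒᵖ` (the category `RMod Λ := ModuleCat Λᵐᵒᵖ`).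

τ-rigidity is formalized via the standard projective-presentation criterion of
Auslander–Smalø/Adachi–Iyama–Reiten: a finitely generated module `M` is τ-rigid iff it admits
a (finite) projective presentation `P₁ → P₀ → M → 0` such that
`Hom(P₀, M) → Hom(P₁, M)` is surjective.
-/

noncomputable section

namespace TwoPoint

/-- A module is indecomposable if it is nonzero and admits no nontrivial direct sum
decomposition. -/
def IsIndecModule (R : Type) [Ring R] (M : Type) [AddCommGroup M] [Module R M] : Prop :=
  Nontrivial M ∧ ∀ N₁ N₂ : Submodule R M, IsCompl N₁ N₂ → N₁ = ⊥ ∨ N₂ = ⊥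

/-- `M` decomposes as a finite direct sum of indecomposable submodules having exactly `n`
isomorphism classes. -/
def HasIndecClassCount (R : Type) [Ring R] (M : ModuleCat.{0} R) (n : ℕ) : Prop :=
  ∃ (k : ℕ) (N : Fin k → Submodule R M),
    DirectSum.IsInternal N ∧ (∀ i, IsIndecModule R (N i)) ∧
    ∃ c : Fin k → Fin n, Function.Surjective c ∧
      ∀ i j, (c i = c j ↔ Nonempty ((N i) ≃ₗ[R] (N j)))

/-- `M` is basic: it decomposes as a finite direct sum of pairwise nonisomorphic
indecomposable submodules. -/
def IsBasicModuleCat (R : Type) [Ring R] (M : ModuleCat.{0} R) : Prop :=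
  ∃ (k : ℕ) (N : Fin k → Submodule R M),
    DirectSum.IsInternal N ∧ (∀ i, IsIndecModule R (N i)) ∧
    ∀ i j, i ≠ j → IsEmpty ((N i) ≃ₗ[R] (N j))

/-- τ-rigidity, via the projective presentation criterion: there is a finite projective
presentation `P₁ —f→ P₀ —g→ M → 0` such that `Hom(—, M)` applied to `f` is surjective,
i.e. `Hom_Λ(M, τM) = 0`. -/
def IsTauRigidCat (R : Type) [Ring R] (M : ModuleCat.{0} R) : Prop :=
  Module.Finite R M ∧
  ∃ (P₁ P₀ : ModuleCat.{0} R) (f : P₁ →ₗ[R] P₀) (g : P₀ →ₗ[R] M),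
    Module.Finite R P₁ ∧ Module.Projective R P₁ ∧
    Module.Finite R P₀ ∧ Module.Projective R P₀ ∧
    Function.Surjective g ∧ LinearMap.range f = LinearMap.ker g ∧
    ∀ h : P₁ →ₗ[R] M, ∃ h' : P₀ →ₗ[R] M, h = h'.comp f

/-- Support τ-tilting module, via support τ-tilting pairs `(M, P)` (Adachi–Iyama–Reiten):
`M` is τ-rigid, `P` is finitely generated projective with `Hom(P, M) = 0`, and
`|M| + |P| = |R|` where `|X|` is the number of isomorphism classes of indecomposable
direct summands. -/
def IsSupportTauTiltingCat (R : Type) [Ring R] (M : ModuleCat.{0} R) : Prop :=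
  IsTauRigidCat R M ∧
  ∃ (P : ModuleCat.{0} R) (p q r : ℕ),
    Module.Finite R P ∧ Module.Projective R P ∧
    (∀ f : P →ₗ[R] M, f = 0) ∧
    HasIndecClassCount R M p ∧ HasIndecClassCount R P q ∧
    HasIndecClassCount R (ModuleCat.of R R) r ∧ p + q = r

/-- The category of (finitely generated) right `Λ`-modules, as left `Λᵐᵒᵖ`-modules. -/
abbrev RMod (Λ : Type) [Ring Λ] := ModuleCat.{0} Λᵐᵒᵖ

/-- Basic support τ-tilting right `Λ`-module. -/
def IsBasicSupportTauTilting (Λ : Type) [Ring Λ] (M : RMod Λ) : Prop :=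
  IsSupportTauTiltingCat Λᵐᵒᵖ M ∧ IsBasicModuleCat Λᵐᵒᵖ M

/-- `Λ` is τ-tilting finite: there are only finitely many isomorphism classes of basic
support τ-tilting right `Λ`-modules. -/
def IsTauTiltingFinite (Λ : Type) [Ring Λ] : Prop :=
  ∃ (n : ℕ) (L : Fin n → RMod Λ),
    ∀ M : RMod Λ, IsBasicSupportTauTilting Λ M → ∃ i, Nonempty (M ≃ₗ[Λᵐᵒᵖ] L i)

/-- `Λ` has exactly `n` isomorphism classes of basic support τ-tilting modules. -/
def SupportTauTiltingCount (Λ : Type) [Ring Λ] (n : ℕ) : Prop :=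
  ∃ L : Fin n → RMod Λ,
    (∀ i, IsBasicSupportTauTilting Λ (L i)) ∧
    (∀ i j, Nonempty ((L i) ≃ₗ[Λᵐᵒᵖ] (L j)) → i = j) ∧
    ∀ M : RMod Λ, IsBasicSupportTauTilting Λ M → ∃ i, Nonempty (M ≃ₗ[Λᵐᵒᵖ] L i)

/-- `Fac M ⊆ Fac N`: every factor module of a finite direct sum of copies of `M` is also a
factor module of a finite direct sum of copies of `N`.  This is the partial order on
support τ-tilting modules. -/
def FacLE (Λ : Type) [Ring Λ] (M N : RMod Λ) : Prop :=
  ∀ X : RMod Λ,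
    (∃ (k : ℕ) (f : (Fin k → M) →ₗ[Λᵐᵒᵖ] X), Function.Surjective f) →
    (∃ (k : ℕ) (f : (Fin k → N) →ₗ[Λᵐᵒᵖ] X), Function.Surjective f)

/-- The Hasse quiver of the poset `sτ-tilt Λ` is of type `H_{m,n}`: the poset of
isomorphism classes of basic support τ-tilting modules is isomorphic to the poset
consisting of a greatest element, a least element, and two incomparable chains with `m`
resp. `n` elements in between (hence two directed paths from `Λ` to `0` with `m` resp. `n`
intermediate vertices). -/
def HasseType (Λ : Type) [Ring Λ] (m n : ℕ) : Prop :=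
  ∃ T : WithTop (WithBot (Fin m ⊕ Fin n)) → RMod Λ,
    (∀ x, IsBasicSupportTauTilting Λ (T x)) ∧
    (∀ x y, Nonempty ((T x) ≃ₗ[Λᵐᵒᵖ] (T y)) → x = y) ∧
    (∀ M : RMod Λ, IsBasicSupportTauTilting Λ M → ∃ x, Nonempty (M ≃ₗ[Λᵐᵒᵖ] T x)) ∧
    ∀ x y, x ≤ y ↔ FacLE Λ (T x) (T y)

/-- `Λ` is τ-tilting finite with exactly `N` basic support τ-tilting modules and Hasse
quiver of type `H_{m,n}`. -/
def TauTiltingData (Λ : Type) [Ring Λ] (N m n : ℕ) : Prop :=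
  IsTauTiltingFinite Λ ∧ SupportTauTiltingCount Λ N ∧ HasseType Λ m n

/-- `B` is a factor algebra of `Λ`: there is a surjective `K`-algebra homomorphism
`Λ → B`. -/
def IsFactorAlgebra (K : Type) [CommRing K] (B Λ : Type) [Ring B] [Ring Λ]
    [Algebra K B] [Algebra K Λ] : Prop :=
  ∃ φ : Λ →ₐ[K] B, Function.Surjective φ

/-- `Λ` is a basic algebra: the regular right module decomposes into pairwise
nonisomorphic indecomposables. -/
def IsBasicAlgebra (Λ : Type) [Ring Λ] : Prop :=
  IsBasicModuleCat Λᵐᵒᵖ (ModuleCat.of Λᵐᵒᵖ Λᵐᵒᵖ)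

/-- `Λ` is representation-finite: finitely many isomorphism classes of indecomposable
finitely generated right modules. -/
def IsRepFinite (Λ : Type) [Ring Λ] : Prop :=
  ∃ (n : ℕ) (L : Fin n → RMod Λ), ∀ M : RMod Λ,
    Module.Finite Λᵐᵒᵖ M → IsIndecModule Λᵐᵒᵖ M → ∃ i, Nonempty (M ≃ₗ[Λᵐᵒᵖ] L i)

end TwoPoint

namespace TwoPoint

/-! ### Bound quiver algebras on two-point quivers

A two-point quiver is given by an arrow type `σ` together with source and target functions
`s t : σ → Fin 2`.  The corresponding bound quiver algebra `KQ/I` is presented as the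
quotient of the free algebra on the two vertex idempotents and the arrows, by the path
algebra relations together with the defining relations of `I` (paths are composed from
left to right, so a relation like `αμβ` is the product `α * μ * β`). -/

/-- Generators for the path algebra of a two-point quiver: two vertex idempotents and the
arrows. -/
inductive TPGen (σ : Type) : Type
  | v : Fin 2 → TPGen σ
  | ar : σ → TPGen σ

/-- The vertex idempotent generator. -/
def vtx (K : Type) [Field K] {σ : Type} (i : Fin 2) : FreeAlgebra K (TPGen σ) :=
  FreeAlgebra.ι K (TPGen.v i)

/-- The arrow generator. -/
def arr (K : Type) [Field K] {σ : Type} (a : σ) : FreeAlgebra K (TPGen σ) :=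
  FreeAlgebra.ι K (TPGen.ar a)

/-- The defining relations of a bound quiver algebra on a two-point quiver:
`e_i e_j = δ_{ij} e_i`, `e_1 + e_2 = 1`, `e_{s(a)} a = a = a e_{t(a)}`, together with the
prescribed relations `rels` (each pair `(x, y) ∈ rels` imposes `x = y`). -/
inductive QuivRel (K : Type) [Field K] (σ : Type) (s t : σ → Fin 2)
    (rels : Set (FreeAlgebra K (TPGen σ) × FreeAlgebra K (TPGen σ))) :
    FreeAlgebra K (TPGen σ) → FreeAlgebra K (TPGen σ) → Prop
  | idem (i : Fin 2) : QuivRel K σ s t rels (vtx K i * vtx K i) (vtx K i)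
  | orth (i j : Fin 2) : i ≠ j → QuivRel K σ s t rels (vtx K i * vtx K j) 0
  | vsum : QuivRel K σ s t rels (vtx K 0 + vtx K 1) 1
  | src (a : σ) : QuivRel K σ s t rels (vtx K (s a) * arr K a) (arr K a)
  | tgt (a : σ) : QuivRel K σ s t rels (arr K a * vtx K (t a)) (arr K a)
  | rel (p : FreeAlgebra K (TPGen σ) × FreeAlgebra K (TPGen σ)) :
      p ∈ rels → QuivRel K σ s t rels p.1 p.2

/-- The bound quiver algebra of a two-point quiver with relations `rels`. -/
abbrev BoundQuiverAlgebra (K : Type) [Field K] (σ : Type) (s t : σ → Fin 2)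
    (rels : Set (FreeAlgebra K (TPGen σ) × FreeAlgebra K (TPGen σ))) : Type :=
  RingQuot (QuivRel K σ s t rels)

/-! Concrete two-point quivers used below.  Vertices are `0` ("1") and `1` ("2"). -/

/- Quiver `μ : 1 → 2`, loop `β` at `2`. -/
namespace QA
def s : Fin 2 → Fin 2 := ![0, 1]
def t : Fin 2 → Fin 2 := ![1, 1]
def mu (K : Type) [Field K] : FreeAlgebra K (TPGen (Fin 2)) := arr K (0 : Fin 2)
def be (K : Type) [Field K] : FreeAlgebra K (TPGen (Fin 2)) := arr K (1 : Fin 2)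
end QA

/- Quiver: loop `α` at `1`, `μ : 1 → 2`, loop `β` at `2`. -/
namespace QB
def s : Fin 3 → Fin 2 := ![0, 0, 1]
def t : Fin 3 → Fin 2 := ![0, 1, 1]
def al (K : Type) [Field K] : FreeAlgebra K (TPGen (Fin 3)) := arr K (0 : Fin 3)
def mu (K : Type) [Field K] : FreeAlgebra K (TPGen (Fin 3)) := arr K (1 : Fin 3)
def be (K : Type) [Field K] : FreeAlgebra K (TPGen (Fin 3)) := arr K (2 : Fin 3)
end QB

/- Quiver: `μ : 1 → 2`, loops `β₁, β₂` at `2`. -/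
namespace QC
def s : Fin 3 → Fin 2 := ![0, 1, 1]
def t : Fin 3 → Fin 2 := ![1, 1, 1]
def mu (K : Type) [Field K] : FreeAlgebra K (TPGen (Fin 3)) := arr K (0 : Fin 3)
def b1 (K : Type) [Field K] : FreeAlgebra K (TPGen (Fin 3)) := arr K (1 : Fin 3)
def b2 (K : Type) [Field K] : FreeAlgebra K (TPGen (Fin 3)) := arr K (2 : Fin 3)
end QC

/- Quiver: loop `α` at `1`, `μ : 1 → 2`, `ν : 2 → 1`. -/
namespace QD
def s : Fin 3 → Fin 2 := ![0, 0, 1]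
def t : Fin 3 → Fin 2 := ![0, 1, 0]
def al (K : Type) [Field K] : FreeAlgebra K (TPGen (Fin 3)) := arr K (0 : Fin 3)
def mu (K : Type) [Field K] : FreeAlgebra K (TPGen (Fin 3)) := arr K (1 : Fin 3)
def nu (K : Type) [Field K] : FreeAlgebra K (TPGen (Fin 3)) := arr K (2 : Fin 3)
end QD

/- Quiver: loops `α` at `1` and `β` at `2`, `μ : 1 → 2`, `ν : 2 → 1`. -/
namespace QE
def s : Fin 4 → Fin 2 := ![0, 1, 0, 1]
def t : Fin 4 → Fin 2 := ![0, 1, 1, 0]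
def al (K : Type) [Field K] : FreeAlgebra K (TPGen (Fin 4)) := arr K (0 : Fin 4)
def be (K : Type) [Field K] : FreeAlgebra K (TPGen (Fin 4)) := arr K (1 : Fin 4)
def mu (K : Type) [Field K] : FreeAlgebra K (TPGen (Fin 4)) := arr K (2 : Fin 4)
def nu (K : Type) [Field K] : FreeAlgebra K (TPGen (Fin 4)) := arr K (3 : Fin 4)
end QE

/- Quiver: `μ : 1 → 2`, `ν : 2 → 1`. -/
namespace QF
def s : Fin 2 → Fin 2 := ![0, 1]
def t : Fin 2 → Fin 2 := ![1, 0]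
def mu (K : Type) [Field K] : FreeAlgebra K (TPGen (Fin 2)) := arr K (0 : Fin 2)
def nu (K : Type) [Field K] : FreeAlgebra K (TPGen (Fin 2)) := arr K (1 : Fin 2)
end QF

/- The Kronecker quiver: `μ₁, μ₂ : 1 → 2`. -/
namespace QG
def s : Fin 2 → Fin 2 := ![0, 0]
def t : Fin 2 → Fin 2 := ![1, 1]
end QG

/- Quiver: `μ₁, μ₂ : 1 → 2`, `ν₁, ν₂ : 2 → 1`. -/
namespace QH
def s : Fin 4 → Fin 2 := ![0, 0, 1, 1]
def t : Fin 4 → Fin 2 := ![1, 1, 0, 0]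
def mu1 (K : Type) [Field K] : FreeAlgebra K (TPGen (Fin 4)) := arr K (0 : Fin 4)
def mu2 (K : Type) [Field K] : FreeAlgebra K (TPGen (Fin 4)) := arr K (1 : Fin 4)
def nu1 (K : Type) [Field K] : FreeAlgebra K (TPGen (Fin 4)) := arr K (2 : Fin 4)
def nu2 (K : Type) [Field K] : FreeAlgebra K (TPGen (Fin 4)) := arr K (3 : Fin 4)
end QH

/- Quiver: loop `α` at `1`, `μ : 1 → 2`. -/
namespace QI
def s : Fin 2 → Fin 2 := ![0, 0]
def t : Fin 2 → Fin 2 := ![0, 1]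
def al (K : Type) [Field K] : FreeAlgebra K (TPGen (Fin 2)) := arr K (0 : Fin 2)
def mu (K : Type) [Field K] : FreeAlgebra K (TPGen (Fin 2)) := arr K (1 : Fin 2)
end QI

/- Quiver: loops `α₁, α₂` at `1`, `μ : 1 → 2`. -/
namespace QJ
def s : Fin 3 → Fin 2 := ![0, 0, 0]
def t : Fin 3 → Fin 2 := ![0, 0, 1]
def a1 (K : Type) [Field K] : FreeAlgebra K (TPGen (Fin 3)) := arr K (0 : Fin 3)
def a2 (K : Type) [Field K] : FreeAlgebra K (TPGen (Fin 3)) := arr K (1 : Fin 3)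
def mu (K : Type) [Field K] : FreeAlgebra K (TPGen (Fin 3)) := arr K (2 : Fin 3)
end QJ

/- Quiver: `μ₁, μ₂ : 1 → 2`, `ν : 2 → 1`. -/
namespace QK
def s : Fin 3 → Fin 2 := ![0, 0, 1]
def t : Fin 3 → Fin 2 := ![1, 1, 0]
def mu1 (K : Type) [Field K] : FreeAlgebra K (TPGen (Fin 3)) := arr K (0 : Fin 3)
def mu2 (K : Type) [Field K] : FreeAlgebra K (TPGen (Fin 3)) := arr K (1 : Fin 3)
def nu (K : Type) [Field K] : FreeAlgebra K (TPGen (Fin 3)) := arr K (2 : Fin 3)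
end QK

/- Quiver: `μ₁, μ₂, μ₃ : 1 → 2`. -/
namespace QL
def s : Fin 3 → Fin 2 := ![0, 0, 0]
def t : Fin 3 → Fin 2 := ![1, 1, 1]
end QL

/- Quiver: loop `α` at `1`, `μ₁, μ₂ : 1 → 2`. -/
namespace QM
def s : Fin 3 → Fin 2 := ![0, 0, 0]
def t : Fin 3 → Fin 2 := ![0, 1, 1]
def al (K : Type) [Field K] : FreeAlgebra K (TPGen (Fin 3)) := arr K (0 : Fin 3)
def mu1 (K : Type) [Field K] : FreeAlgebra K (TPGen (Fin 3)) := arr K (1 : Fin 3)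
def mu2 (K : Type) [Field K] : FreeAlgebra K (TPGen (Fin 3)) := arr K (2 : Fin 3)
end QM

end TwoPoint

namespace TwoPoint

open CategoryTheory

/-! ### The algebras `D₁, …, D₄` (tame blocks of Hecke algebras of classical type) -/

/-- Relations for `D₁`: one vertex with two loops `α, β`, `α² = β² = 0`, `αβ = βα`.
(The path algebra of a one-vertex quiver is the free algebra on its loops.) -/
inductive D1Rel (K : Type) [Field K] : FreeAlgebra K (Fin 2) → FreeAlgebra K (Fin 2) → Prop
  | asq : D1Rel K (FreeAlgebra.ι K (0 : Fin 2) * FreeAlgebra.ι K (0 : Fin 2)) 0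
  | bsq : D1Rel K (FreeAlgebra.ι K (1 : Fin 2) * FreeAlgebra.ι K (1 : Fin 2)) 0
  | comm : D1Rel K (FreeAlgebra.ι K (0 : Fin 2) * FreeAlgebra.ι K (1 : Fin 2))
      (FreeAlgebra.ι K (1 : Fin 2) * FreeAlgebra.ι K (0 : Fin 2))

/-- `D₁`: `K⟨α, β⟩ / (α², β², αβ − βα)`. -/
abbrev HeckeD1 (K : Type) [Field K] : Type := RingQuot (D1Rel K)

/-- `D₂`: `αμ = να = 0`, `α² = (μν)²`. -/
abbrev HeckeD2 (K : Type) [Field K] : Type :=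
  BoundQuiverAlgebra K (Fin 3) QD.s QD.t
    {(QD.al K * QD.mu K, 0), (QD.nu K * QD.al K, 0),
     (QD.al K ^ 2, (QD.mu K * QD.nu K) ^ 2)}

/-- `D₃`: `αμ = μβ = βν = να = 0`, `α² = μν`, `β² = νμ`. -/
abbrev HeckeD3 (K : Type) [Field K] : Type :=
  BoundQuiverAlgebra K (Fin 4) QE.s QE.t
    {(QE.al K * QE.mu K, 0), (QE.mu K * QE.be K, 0), (QE.be K * QE.nu K, 0),
     (QE.nu K * QE.al K, 0), (QE.al K ^ 2, QE.mu K * QE.nu K),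
     (QE.be K ^ 2, QE.nu K * QE.mu K)}

/-- `D₄`: `αμ = μβ = βν = να = 0`, `α² = (μν)²`, `β² = (νμ)²`. -/
abbrev HeckeD4 (K : Type) [Field K] : Type :=
  BoundQuiverAlgebra K (Fin 4) QE.s QE.t
    {(QE.al K * QE.mu K, 0), (QE.mu K * QE.be K, 0), (QE.be K * QE.nu K, 0),
     (QE.nu K * QE.al K, 0), (QE.al K ^ 2, (QE.mu K * QE.nu K) ^ 2),
     (QE.be K ^ 2, (QE.nu K * QE.mu K) ^ 2)}

/-- Morita equivalence: the categories of (right) modules are equivalent. -/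
def MoritaEquivalent (Λ₁ Λ₂ : Type) [Ring Λ₁] [Ring Λ₂] : Prop :=
  Nonempty (RMod Λ₁ ≌ RMod Λ₂)

end TwoPoint

namespace TwoPoint

section General

variable {R : Type} [Ring R]

/-- Every extension of `N` by a quotient of `M` splits. -/
def SplitsOver (R : Type) [Ring R] (N M : Type) [AddCommGroup N] [Module R N]
    [AddCommGroup M] [Module R M] : Prop :=
  ∀ (X E : Type) [AddCommGroup X] [Module R X] [AddCommGroup E] [Module R E]
    (i : X →ₗ[R] E) (g : E →ₗ[R] N) (π : M →ₗ[R] X),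
    Function.Injective i → Function.Surjective g → LinearMap.range i = LinearMap.ker g →
    Function.Surjective π → ∃ s : N →ₗ[R] E, g ∘ₗ s = LinearMap.id

variable {N N' M M' : Type} [AddCommGroup N] [Module R N] [AddCommGroup N'] [Module R N']
  [AddCommGroup M] [Module R M] [AddCommGroup M'] [Module R M']

theorem SplitsOver.of_retract (h : SplitsOver R N M) (a : N' →ₗ[R] N) (b : N →ₗ[R] N')
    (hab : b ∘ₗ a = LinearMap.id) : SplitsOver R N' M := by
  intro X E _ _ _ _ i g π hi hg hig hπ
  let E' : Submodule R (E × N) :=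
    LinearMap.ker (g ∘ₗ LinearMap.fst R E N - b ∘ₗ LinearMap.snd R E N)
  have hE' : ∀ z : E × N, z ∈ E' ↔ g z.1 = b z.2 := fun z => by
    simp [E', LinearMap.mem_ker, sub_eq_zero]
  have hgi : ∀ x, g (i x) = 0 := fun x =>
    LinearMap.mem_ker.1 (hig ▸ LinearMap.mem_range_self i x)
  let i' : X →ₗ[R] E' := (LinearMap.inl R E N ∘ₗ i).codRestrict E' fun x => by
    simp [hE', hgi]
  have hi' : ∀ x, (i' x : E × N) = (i x, 0) := fun _ => rfl
  let g' : E' →ₗ[R] N := LinearMap.snd R E N ∘ₗ E'.subtype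
  obtain ⟨s, hs⟩ := h X E' i' g' π
    (fun x y hxy => hi (by simpa [hi'] using congrArg (fun z : E' => (z : E × N).1) hxy))
    (fun n => by
      obtain ⟨y, hy⟩ := hg (b n)
      exact ⟨⟨(y, n), (hE' _).2 hy⟩, rfl⟩)
    (by
      ext ⟨⟨y, n⟩, hz⟩
      have hz' : g y = b n := (hE' _).1 hz
      constructor
      · rintro ⟨x, hx⟩
        have := congrArg (fun z : E' => (z : E × N).2) hx
        simpa [LinearMap.mem_ker, g', hi'] using this.symm
      · intro hk
        have hn : n = 0 := by simpa [LinearMap.mem_ker, g'] using hk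
        have : y ∈ LinearMap.range i := by rw [hig, LinearMap.mem_ker, hz', hn, map_zero]
        obtain ⟨x, hx⟩ := this
        exact ⟨x, Subtype.ext (Prod.ext hx hn.symm)⟩) hπ
  refine ⟨LinearMap.fst R E N ∘ₗ E'.subtype ∘ₗ s ∘ₗ a, LinearMap.ext fun n => ?_⟩
  have h1 := (hE' _).1 (s (a n)).2
  have h2 : (s (a n) : E × N).2 = a n := LinearMap.congr_fun hs (a n)
  have h3 := LinearMap.congr_fun hab n
  simp only [LinearMap.comp_apply, LinearMap.id_apply] at h3
  simp [h1, h2, h3]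

theorem SplitsOver.of_surjective (h : SplitsOver R N M) (f : M →ₗ[R] M')
    (hf : Function.Surjective f) : SplitsOver R N M' := by
  intro X E _ _ _ _ i g π hi hg hig hπ
  exact h X E i g (π ∘ₗ f) hi hg hig (hπ.comp hf)

/-- A homomorphism from the kernel of an epimorphism onto `N` to a quotient of `M` extends. -/
theorem SplitsOver.exists_extension (h : SplitsOver R N M) {P X : Type} [AddCommGroup P]
    [Module R P] [AddCommGroup X] [Module R X] (g : P →ₗ[R] N) (hg : Function.Surjective g)
    (π : M →ₗ[R] X) (hπ : Function.Surjective π) (φ : LinearMap.ker g →ₗ[R] X) :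
    ∃ ψ : P →ₗ[R] X, ∀ k : LinearMap.ker g, ψ k = φ k := by
  let W : Submodule R (P × X) :=
    LinearMap.range ((LinearMap.ker g).subtype.prod (-φ))
  let i : X →ₗ[R] (P × X) ⧸ W := W.mkQ ∘ₗ LinearMap.inr R P X
  have hW : W ≤ LinearMap.ker (g ∘ₗ LinearMap.fst R P X) := by
    rintro _ ⟨k, rfl⟩
    simp
  let q : (P × X) ⧸ W →ₗ[R] N := W.liftQ (g ∘ₗ LinearMap.fst R P X) hW
  have hi : Function.Injective i := by
    rw [← LinearMap.ker_eq_bot, LinearMap.ker_eq_bot']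
    intro x hx
    have : (0, x) ∈ W := by simpa [i] using hx
    obtain ⟨k, hk⟩ := this
    have h1 : (k : P) = 0 := congrArg Prod.fst hk
    have h2 : -φ k = x := congrArg Prod.snd hk
    have : k = 0 := Subtype.ext h1
    rw [← h2, this, map_zero, neg_zero]
  have hiq : LinearMap.range i = LinearMap.ker q := by
    ext z
    obtain ⟨⟨p, x⟩, rfl⟩ := W.mkQ_surjective z
    constructor
    · rintro ⟨y, hy⟩
      rw [← hy]
      simp [i, q]
    · intro hz
      have hp : g p = 0 := by simpa [q] using hz
      refine ⟨x + φ ⟨p, hp⟩, ?_⟩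
      have : (0, x + φ ⟨p, hp⟩) - (p, x) ∈ W := ⟨-⟨p, hp⟩, by simp⟩
      exact (Submodule.Quotient.eq W).2 this
  obtain ⟨s, hs⟩ := h X _ i q π hi
    (fun n => by
      obtain ⟨p, hp⟩ := hg n
      exact ⟨W.mkQ (p, 0), by simpa [q] using hp⟩) hiq hπ
  let d : P →ₗ[R] (P × X) ⧸ W := W.mkQ ∘ₗ LinearMap.inl R P X - s ∘ₗ g
  have hd : ∀ p, d p ∈ LinearMap.range i := by
    intro p
    rw [hiq, LinearMap.mem_ker]
    have := LinearMap.congr_fun hs (g p)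
    simp only [LinearMap.comp_apply, LinearMap.id_apply] at this
    simp [d, this, q]
  let ei := LinearEquiv.ofInjective i hi
  refine ⟨ei.symm.toLinearMap ∘ₗ d.codRestrict _ hd, fun k => ?_⟩
  simp only [LinearMap.comp_apply, LinearEquiv.coe_coe]
  rw [LinearEquiv.symm_apply_eq]
  apply Subtype.ext
  have hk : g k = 0 := k.2
  have : (((k : P), (0 : X)) : P × X) - (0, φ k) ∈ W := ⟨k, by simp⟩
  have h2 := (Submodule.Quotient.eq W).2 this
  simpa [d, hk, ei, i] using h2

theorem IsTauRigidCat.splitsOver {M : ModuleCat.{0} R} (h : IsTauRigidCat R M) :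
    SplitsOver R M M := by
  obtain ⟨-, P₁, P₀, f, g, -, hP₁, -, hP₀, hg, hfg, hf⟩ := h
  intro X E _ _ _ _ i q π hi hq hiq hπ
  obtain ⟨k, hk⟩ := Module.projective_lifting_property q g hq
  have hk' : ∀ p, q (k p) = g p := fun p => LinearMap.congr_fun hk p
  have hkf : ∀ p, k (f p) ∈ LinearMap.range i := fun p => by
    rw [hiq, LinearMap.mem_ker, hk', ← LinearMap.mem_ker, ← hfg]
    exact LinearMap.mem_range_self f p
  let ei := LinearEquiv.ofInjective i hi
  let h₀ : P₁ →ₗ[R] X := ei.symm.toLinearMap ∘ₗ (k ∘ₗ f).codRestrict _ hkf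
  have hh₀ : ∀ p, i (h₀ p) = k (f p) := fun p => by
    exact congrArg Subtype.val (ei.apply_symm_apply ((k ∘ₗ f).codRestrict _ hkf p))
  obtain ⟨h₁, hh₁⟩ := Module.projective_lifting_property π h₀ hπ
  obtain ⟨h₂, hh₂⟩ := hf h₁
  let ψ := π ∘ₗ h₂
  have hψ : ∀ p, ψ (f p) = h₀ p := fun p => by
    rw [← hh₁, hh₂]; rfl
  let d : P₀ →ₗ[R] E := k - i ∘ₗ ψ
  have hd : LinearMap.ker g ≤ LinearMap.ker d := by
    rw [← hfg]
    rintro _ ⟨p, rfl⟩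
    simp [d, hψ, hh₀]
  refine ⟨(LinearMap.ker g).liftQ d hd ∘ₗ
    (g.quotKerEquivOfSurjective hg).symm.toLinearMap, LinearMap.ext fun m => ?_⟩
  obtain ⟨p, rfl⟩ := hg m
  have : (g.quotKerEquivOfSurjective hg).symm (g p) = (LinearMap.ker g).mkQ p := by
    rw [LinearEquiv.symm_apply_eq]; rfl
  have hqi : q (i (ψ p)) = 0 := LinearMap.mem_ker.1 (hiq ▸ LinearMap.mem_range_self i _)
  simp [this, d, hqi, hk']

theorem IsIndecModule.of_equiv (e : N ≃ₗ[R] N') (h : IsIndecModule R N) :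
    IsIndecModule R N' := by
  refine ⟨e.symm.toEquiv.nontrivial_congr.2 h.1, fun A B hAB => ?_⟩
  have := h.2 _ _ (((Submodule.orderIsoMapComap e.symm).isCompl_iff).1 hAB)
  simpa using this

/-- An indecomposable module isomorphic to a finite product is isomorphic to each nontrivial
factor. -/
theorem IsIndecModule.equiv_factor (h : IsIndecModule R N) {ι : Type}
    [DecidableEq ι] {Q : ι → Type} [∀ i, AddCommGroup (Q i)] [∀ i, Module R (Q i)]
    (e : N ≃ₗ[R] (∀ i, Q i)) (i : ι) [Nontrivial (Q i)] :
    Function.Bijective (LinearMap.proj i ∘ₗ e.toLinearMap : N →ₗ[R] Q i) := by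
  have hc : IsCompl (LinearMap.ker (LinearMap.proj i : (∀ i, Q i) →ₗ[R] Q i))
      (LinearMap.range (LinearMap.single R Q i)) := by
    refine IsCompl.of_le ?_ ?_
    · rintro x ⟨hx, y, rfl⟩
      have : y = 0 := by simpa using hx
      simp [this]
    · intro x _
      rw [← sub_add_cancel x (LinearMap.single R Q i (x i))]
      exact Submodule.add_mem_sup (by simp) (LinearMap.mem_range_self _ _)
  refine ⟨?_, ?_⟩
  · rcases (h.of_equiv e).2 _ _ hc with h0 | h0
    · exact (LinearMap.ker_eq_bot.1 h0).comp e.injective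
    · obtain ⟨y, hy⟩ := exists_ne (0 : Q i)
      have := LinearMap.mem_range_self (LinearMap.single R Q i) y
      rw [h0, Submodule.mem_bot] at this
      exact absurd (by simpa using this) hy
  · exact (LinearMap.proj_surjective (R := R) i).comp e.surjective

/-- A finite internal direct sum is a product. -/
def internalEquiv {k : ℕ} {A : Fin k → Submodule R M} (h : DirectSum.IsInternal A) :
    M ≃ₗ[R] (∀ i, A i) :=
  (LinearEquiv.ofBijective (DirectSum.coeLinearMap A) h).symm ≪≫ₗ
    DirectSum.linearEquivFunOnFintype R (Fin k) (fun i => A i)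

theorem internalEquiv_symm_single {k : ℕ} {A : Fin k → Submodule R M}
    (h : DirectSum.IsInternal A) (i : Fin k) (x : A i) :
    (internalEquiv h).symm (Pi.single i x) = x := by
  rw [LinearEquiv.symm_apply_eq]
  simp only [internalEquiv, LinearEquiv.trans_apply]
  have : (LinearEquiv.ofBijective (DirectSum.coeLinearMap A) h).symm (x : M) =
      DirectSum.lof R (Fin k) (fun i => A i) i x := by
    rw [LinearEquiv.symm_apply_eq]
    exact (DirectSum.coeLinearMap_lof A i x).symm
  rw [this, DirectSum.linearEquivFunOnFintype_lof]

/-- The projection onto a summand of a finite internal direct sum. -/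
def internalProj {k : ℕ} {A : Fin k → Submodule R M} (h : DirectSum.IsInternal A) (i : Fin k) :
    M →ₗ[R] A i :=
  LinearMap.proj i ∘ₗ (internalEquiv h).toLinearMap

theorem internalProj_subtype {k : ℕ} {A : Fin k → Submodule R M} (h : DirectSum.IsInternal A)
    (i : Fin k) : internalProj h i ∘ₗ (A i).subtype = LinearMap.id := by
  ext x
  have := internalEquiv_symm_single h i x
  rw [LinearEquiv.symm_apply_eq] at this
  simp [internalProj, ← this]

/-- A module isomorphic to a finite product decomposes internally. -/
theorem exists_internal {ι : Type} [Fintype ι] [DecidableEq ι] {Q : ι → Type}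
    [∀ i, AddCommGroup (Q i)] [∀ i, Module R (Q i)] (e : M ≃ₗ[R] (∀ i, Q i)) :
    ∃ A : Fin (Fintype.card ι) → Submodule R M, DirectSum.IsInternal A ∧
      ∀ i, Nonempty (A i ≃ₗ[R] Q ((Fintype.equivFin ι).symm i)) := by
  let f : ∀ i, Q i →ₗ[R] M := fun i => e.symm.toLinearMap ∘ₗ LinearMap.single R Q i
  have hf : ∀ i, Function.Injective (f i) := fun i =>
    e.symm.injective.comp (Pi.single_injective i)
  have hr : ∀ i, LinearMap.range (f i) =
      Submodule.orderIsoMapComap e.symm (LinearMap.range (LinearMap.single R Q i)) := fun i => by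
    simp [f, LinearMap.range_comp]
  have hsup : iSup (fun i => LinearMap.range (LinearMap.single R Q i)) = ⊤ :=
    LinearMap.iSup_range_single R Q
  have hind : iSupIndep (fun i => LinearMap.range (LinearMap.single R Q i)) := by
    intro i
    have := LinearMap.disjoint_single_single R Q {i} {i}ᶜ disjoint_compl_right
    simpa using this
  refine ⟨fun i => LinearMap.range (f ((Fintype.equivFin ι).symm i)), ?_,
    fun i => ⟨(LinearEquiv.ofInjective _ (hf _)).symm⟩⟩
  rw [DirectSum.isInternal_submodule_iff_iSupIndep_and_iSup_eq_top]
  constructor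
  · have := (hind.map_orderIso (Submodule.orderIsoMapComap e.symm)).comp
      (Fintype.equivFin ι).symm.injective
    convert this using 2
    exact hr _
  · rw [(Fintype.equivFin ι).symm.iSup_comp (g := fun i => LinearMap.range (f i))]
    simp_rw [hr]
    rw [← OrderIso.map_iSup, hsup, map_top]

theorem hasIndecClassCount_of_equiv {ι : Type} [Fintype ι] [DecidableEq ι] {Q : ι → Type}
    [∀ i, AddCommGroup (Q i)] [∀ i, Module R (Q i)] {M : ModuleCat.{0} R}
    (e : M ≃ₗ[R] (∀ i, Q i)) (hQ : ∀ i, IsIndecModule R (Q i))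
    (hQ' : ∀ i j, Nonempty (Q i ≃ₗ[R] Q j) → i = j) :
    HasIndecClassCount R M (Fintype.card ι) := by
  obtain ⟨A, hA, hAQ⟩ := exists_internal e
  refine ⟨_, A, hA, fun i => (hQ _).of_equiv (hAQ i).some.symm, id,
    Function.surjective_id, fun i j => ⟨?_, ?_⟩⟩
  · rintro rfl
    exact ⟨LinearEquiv.refl R _⟩
  · rintro ⟨t⟩
    exact (Fintype.equivFin ι).symm.injective
      (hQ' _ _ ⟨(hAQ i).some.symm ≪≫ₗ t ≪≫ₗ (hAQ j).some⟩)

theorem isBasicModuleCat_of_equiv {ι : Type} [Fintype ι] [DecidableEq ι] {Q : ι → Type}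
    [∀ i, AddCommGroup (Q i)] [∀ i, Module R (Q i)] {M : ModuleCat.{0} R}
    (e : M ≃ₗ[R] (∀ i, Q i)) (hQ : ∀ i, IsIndecModule R (Q i))
    (hQ' : ∀ i j, Nonempty (Q i ≃ₗ[R] Q j) → i = j) :
    IsBasicModuleCat R M := by
  obtain ⟨A, hA, hAQ⟩ := exists_internal e
  refine ⟨_, A, hA, fun i => (hQ _).of_equiv (hAQ i).some.symm, fun i j hij => ⟨fun t => ?_⟩⟩
  exact hij ((Fintype.equivFin ι).symm.injective
      (hQ' _ _ ⟨(hAQ i).some.symm ≪≫ₗ t ≪≫ₗ (hAQ j).some⟩))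

/-- A basic module whose indecomposable summands are all of the form `Q a` is the product of the
`Q a` over a finite set. -/
theorem IsBasicModuleCat.exists_finset {κ : Type} [DecidableEq κ] {Q : κ → Type}
    [∀ i, AddCommGroup (Q i)] [∀ i, Module R (Q i)] {M : ModuleCat.{0} R}
    (h : IsBasicModuleCat R M)
    (hQ : ∀ (A : Submodule R M) (p : M →ₗ[R] A), p ∘ₗ A.subtype = LinearMap.id →
      IsIndecModule R A → ∃ a, Nonempty (A ≃ₗ[R] Q a)) :
    ∃ S : Finset κ, Nonempty (M ≃ₗ[R] (∀ q : S, Q q)) := by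
  obtain ⟨k, A, hA, hind, hne⟩ := h
  have := fun i => hQ (A i) (internalProj hA i) (internalProj_subtype hA i) (hind i)
  choose σ hσ using this
  have hinj : Function.Injective σ := by
    intro i j hij
    by_contra hne'
    refine (hne i j hne').false ((hσ i).some ≪≫ₗ ?_ ≪≫ₗ (hσ j).some.symm)
    exact hij ▸ LinearEquiv.refl R _
  let S : Finset κ := Finset.univ.map ⟨σ, hinj⟩
  let τ : Fin k ≃ S := Equiv.ofBijective (fun i => ⟨σ i, by simp [S]⟩) ⟨fun i j hij =>
    hinj (congrArg Subtype.val hij), fun ⟨q, hq⟩ => by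
      obtain ⟨i, -, rfl⟩ := Finset.mem_map.1 hq
      exact ⟨i, rfl⟩⟩
  exact ⟨S, ⟨internalEquiv hA ≪≫ₗ LinearEquiv.piCongrRight (fun i => (hσ i).some) ≪≫ₗ
    LinearEquiv.piCongrLeft R (fun q : S => Q q) τ⟩⟩

end General

/-- A `K`-algebra `R` with a complete family `e` of orthogonal idempotents and a two-sided ideal
`J`, nilpotent in the sense that some descending chain `filt` with `J * filt n ≤ filt (n + 1)`
reaches `0`, such that `R / J` is a product of copies of `K` indexed by the idempotents. -/
structure BasicData (K : Type) [Field K] (V : Type) [Fintype V] [DecidableEq V]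
    (R : Type) [Ring R] [Algebra K R] where
  e : V → R
  J : Ideal R
  mul_mem_right : ∀ x ∈ J, ∀ r, x * r ∈ J
  filt : ℕ → Ideal R
  filt_zero : filt 0 = ⊤
  mul_filt : ∀ n, J * filt n ≤ filt (n + 1)
  filt_bot : ∃ n, filt n = ⊥
  mul_self : ∀ v, e v * e v = e v
  mul_ne : ∀ v w, v ≠ w → e v * e w = 0
  sum_e : ∑ v, e v = 1
  e_ne : ∀ v, e v ≠ 0
  residue : ∀ v r, ∃ a : K, e v * r - a • e v ∈ J ∧ r * e v - a • e v ∈ J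

namespace BasicData

variable {K : Type} [Field K] {V : Type} [Fintype V] [DecidableEq V]
  {R : Type} [Ring R] [Algebra K R] (D : BasicData K V R)
  {N M X : Type} [AddCommGroup N] [Module R N] [AddCommGroup M] [Module R M]
  [AddCommGroup X] [Module R X]

theorem sum_smul (x : N) : ∑ v, D.e v • x = x := by
  rw [← Finset.sum_smul, D.sum_e, one_smul]

theorem sum_mul (x : R) : ∑ v, D.e v * x = x := D.sum_smul x

theorem le_of_le_sup_smul {A B : Submodule R N} (h : A ≤ B ⊔ D.J • A) : A ≤ B := by
  have key : ∀ n, A ≤ B ⊔ D.filt n • A := by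
    intro n
    induction n with
    | zero => rw [D.filt_zero, Submodule.top_smul]; exact le_sup_right
    | succ n ih =>
      refine h.trans (sup_le le_sup_left ?_)
      refine (smul_mono_right _ ih).trans ?_
      rw [Submodule.smul_sup, ← Submodule.mul_smul]
      exact sup_le_sup Submodule.smul_le_right (Submodule.smul_mono_left (D.mul_filt n))
  obtain ⟨n, hn⟩ := D.filt_bot
  simpa [hn] using key n

theorem pow_mem_filt {y : R} (hy : y ∈ D.J) (n : ℕ) : y ^ n ∈ D.filt n := by
  induction n with
  | zero => simp [D.filt_zero]
  | succ n ih => rw [pow_succ']; exact D.mul_filt n (Ideal.mul_mem_mul hy ih)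

theorem isNilpotent_of_mem {y : R} (hy : y ∈ D.J) : IsNilpotent y := by
  obtain ⟨n, hn⟩ := D.filt_bot
  exact ⟨n, by simpa [hn] using D.pow_mem_filt hy n⟩

theorem e_notMem (v : V) : D.e v ∉ D.J := by
  intro h
  obtain ⟨n, hn⟩ := D.isNilpotent_of_mem h
  have : IsIdempotentElem (D.e v) := D.mul_self v
  rcases n with _ | n
  · have h1 : (1 : R) = 0 := by simpa using hn
    exact D.e_ne v (by rw [← mul_one (D.e v), h1, mul_zero])
  · rw [this.pow_succ_eq] at hn
    exact D.e_ne v hn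

theorem off_diag {v w : V} (h : v ≠ w) (r : R) : D.e v * r * D.e w ∈ D.J := by
  obtain ⟨a, -, ha⟩ := D.residue w r
  have := D.J.mul_mem_left (D.e v) ha
  rwa [mul_sub, mul_smul_comm, D.mul_ne v w h, smul_zero, sub_zero, ← mul_assoc] at this

theorem exists_inv {v : V} {r : R} (h : D.e v * r * D.e v ∉ D.J) :
    ∃ w, w * (D.e v * r * D.e v) = D.e v ∧ (D.e v * r * D.e v) * w = D.e v := by
  set u := D.e v * r * D.e v with hu
  obtain ⟨a, ha, -⟩ := D.residue v r
  have hy : u - a • D.e v ∈ D.J := by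
    have := D.mul_mem_right _ ha (D.e v)
    rwa [sub_mul, smul_mul_assoc, D.mul_self] at this
  have ha0 : a ≠ 0 := by
    rintro rfl
    exact h (by simpa using hy)
  have hu1 : D.e v * u = u := by simp only [hu, ← mul_assoc, D.mul_self]
  have hu2 : u * D.e v = u := by simp only [hu, mul_assoc, D.mul_self]
  have hy' : a⁻¹ • u - D.e v ∈ D.J := by
    have := D.J.mul_mem_left (algebraMap K R a⁻¹) hy
    rwa [← Algebra.smul_def, smul_sub, smul_smul, inv_mul_cancel₀ ha0, one_smul] at this
  obtain ⟨z, hz⟩ := (D.isNilpotent_of_mem hy').isUnit_one_add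
  have h1 : (z : R) * D.e v = a⁻¹ • u := by
    rw [hz, add_mul, sub_mul, smul_mul_assoc, hu2, D.mul_self, one_mul]; abel
  have h2 : D.e v * (z : R) = a⁻¹ • u := by
    rw [hz, mul_add, mul_sub, mul_smul_comm, hu1, D.mul_self, mul_one]; abel
  refine ⟨a⁻¹ • (↑z⁻¹ : R), ?_, ?_⟩
  · rw [smul_mul_assoc, ← mul_smul_comm, ← h1, ← mul_assoc, Units.inv_mul, one_mul]
  · rw [mul_smul_comm, ← smul_mul_assoc, ← h2, mul_assoc, Units.mul_inv, mul_one]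

/-- The projective module `R e_v`. -/
def P (v : V) : Submodule R R := Submodule.span R {D.e v}

theorem mem_P {v : V} {r : R} : r ∈ D.P v ↔ r * D.e v = r := by
  rw [P, Submodule.mem_span_singleton]
  constructor
  · rintro ⟨a, rfl⟩
    rw [smul_eq_mul, mul_assoc, D.mul_self]
  · exact fun h => ⟨r, h⟩

@[simp] theorem coe_mul_e {v : V} (p : D.P v) : (p : R) * D.e v = p := D.mem_P.1 p.2

/-- The generator `e_v` of `R e_v`. -/
def gen (v : V) : D.P v := ⟨D.e v, D.mem_P.2 (D.mul_self v)⟩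

@[simp] theorem coe_gen (v : V) : (D.gen v : R) = D.e v := rfl

theorem smul_gen {v : V} (p : D.P v) : (p : R) • D.gen v = p := Subtype.ext (by simp)

/-- The homomorphism `R e_v → N` sending `e_v` to `e_v y`. -/
def lift (v : V) (y : N) : D.P v →ₗ[R] N :=
  LinearMap.toSpanSingleton R N y ∘ₗ (D.P v).subtype

@[simp] theorem lift_apply (v : V) (y : N) (p : D.P v) : D.lift v y p = (p : R) • y := rfl

instance projective_P (v : V) : Module.Projective R (D.P v) :=
  Module.Projective.of_split (D.P v).subtype
    ((LinearMap.toSpanSingleton R R (D.e v)).codRestrict (D.P v) fun r =>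
      D.mem_P.2 (by simp [mul_assoc, D.mul_self])) (by ext p; simp)

instance finite_P (v : V) : Module.Finite R (D.P v) :=
  Module.Finite.of_fg (Submodule.fg_span_singleton _)

/-- An element of `R e_v` outside the radical is a generator. -/
theorem exists_mul_eq {v : V} {r : R} (hr : r ∈ D.P v) (h : r ∉ D.J) :
    ∃ w, w * (D.e v * r) = D.e v ∧ D.e v * r * w = D.e v := by
  have h0 : D.e v * r * D.e v ∉ D.J := by
    intro h1
    apply h
    rw [← D.sum_mul r]
    refine D.J.sum_mem fun u _ => ?_
    rw [← D.mem_P.1 hr, ← mul_assoc]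
    by_cases huv : u = v
    · rwa [huv]
    · exact D.off_diag huv r
  obtain ⟨w, h1, h2⟩ := D.exists_inv h0
  rw [mul_assoc (D.e v) r, D.mem_P.1 hr] at h1 h2
  exact ⟨w, h1, h2⟩

/-- Homomorphisms detecting elements of a submodule outside its radical. -/
theorem exists_hom_ne_zero [Module K N] [IsScalarTower K R N] {A : Submodule R N} {v : V}
    (k : A) (hk : D.e v • (k : N) ∉ D.J • A) {s : X} (hs : D.e v • s = s) (hs0 : s ≠ 0)
    (hJ : ∀ y ∈ D.J, y • s = 0) : ∃ φ : A →ₗ[R] X, φ k ≠ 0 := by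
  obtain ⟨f, hf, hfA⟩ := Submodule.exists_le_ker_of_notMem
    (p := (D.J • A).restrictScalars K) hk
  have hfA' : ∀ z ∈ D.J • A, f z = 0 := fun z hz => hfA hz
  have hadd : ∀ (a b : K), algebraMap K R (a + b) • s =
      algebraMap K R a • s + algebraMap K R b • s := fun a b => by rw [map_add, add_smul]
  let φ : A →ₗ[R] X :=
    { toFun := fun x => algebraMap K R (f (D.e v • (x : N))) • s
      map_add' := fun x y => by rw [← hadd, ← map_add, ← smul_add]; rfl
      map_smul' := fun r x => by
        obtain ⟨a, ha, ha'⟩ := D.residue v r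
        have h1 : f (D.e v • (r • (x : N))) = a * f (D.e v • (x : N)) := by
          have := hfA' _ (Submodule.smul_mem_smul ha x.2)
          rw [sub_smul, map_sub, sub_eq_zero, mul_smul, smul_assoc] at this
          exact this.trans (f.map_smul a _)
        have h2 : r • s = algebraMap K R a • s := by
          have := hJ _ ha'
          rw [sub_smul, sub_eq_zero, mul_smul, hs, Algebra.smul_def, mul_smul, hs] at this
          exact this
        simp only [Submodule.coe_smul, RingHom.id_apply]
        rw [h1, mul_comm, map_mul, mul_smul, ← h2, ← mul_smul, ← mul_smul, Algebra.commutes] }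
  refine ⟨φ, fun h0 => hs0 ?_⟩
  have h1 : algebraMap K R (f (D.e v • (k : N))) • s = 0 := h0
  have := congrArg (fun z => algebraMap K R (f (D.e v • (k : N)))⁻¹ • z) h1
  simpa [← mul_smul, ← map_mul, inv_mul_cancel₀ hf] using this

section Cover

variable {ι : Type} [Fintype ι]

/-- The homomorphism from a direct sum of the projectives `R e_v` determined by elements. -/
def cover (c : ι → V) (x : ι → N) : (∀ i, D.P (c i)) →ₗ[R] N :=
  ∑ i, D.lift (c i) (x i) ∘ₗ LinearMap.proj i

theorem cover_apply (c : ι → V) (x : ι → N) (p : ∀ i, D.P (c i)) :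
    D.cover c x p = ∑ i, (p i : R) • x i := by
  simp [cover]

theorem apply_eq_sum [DecidableEq ι] {c : ι → V}
    (ψ : (∀ i, D.P (c i)) →ₗ[R] X) (p : ∀ i, D.P (c i)) :
    ψ p = ∑ i, (p i : R) • ψ (Pi.single i (D.gen (c i))) := by
  have : p = ∑ i, (p i : R) • (Pi.single i (D.gen (c i)) : ∀ i, D.P (c i)) := by
    rw [← Finset.univ_sum_single p]
    refine Finset.sum_congr rfl fun i _ => ?_
    rw [← Pi.single_smul, Finset.univ_sum_single, D.smul_gen]
  conv_lhs => rw [this]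
  simp

end Cover

/-- Every finitely generated module has a projective cover. -/
theorem exists_cover [Module.Finite R N] :
    ∃ (ι : Type) (_ : Fintype ι) (c : ι → V) (x : ι → N),
      Function.Surjective (D.cover c x) ∧
      ∀ p ∈ LinearMap.ker (D.cover c x), ∀ i, (p i : R) ∈ D.J := by
  classical
  let good : Set (Finset N) :=
    {s | (∀ x ∈ s, ∃ v, D.e v • x = x) ∧ Submodule.span R (s : Set N) = ⊤}
  have hgood : good.Nonempty := by
    obtain ⟨s, hs⟩ := Module.Finite.fg_top (R := R) (M := N)
    refine ⟨(s ×ˢ Finset.univ).image fun q : N × V => D.e q.2 • q.1, ?_, ?_⟩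
    · intro x hx
      obtain ⟨⟨y, v⟩, -, rfl⟩ := Finset.mem_image.1 hx
      exact ⟨v, by rw [← mul_smul, D.mul_self]⟩
    · rw [eq_top_iff, ← hs, Submodule.span_le]
      intro y hy
      rw [SetLike.mem_coe, ← D.sum_smul y]
      refine Submodule.sum_mem _ fun v _ => Submodule.subset_span ?_
      exact Finset.mem_coe.2 (Finset.mem_image.2 ⟨(y, v), by simpa using hy, rfl⟩)
  obtain ⟨s, ⟨hs, hspan⟩, hmin⟩ := (measure Finset.card).wf.has_min good hgood
  choose c hc using hs
  refine ⟨s, inferInstance, fun x => c x.1 x.2, fun x => x, ?_, ?_⟩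
  · rw [← LinearMap.range_eq_top, eq_top_iff, ← hspan, Submodule.span_le]
    intro y hy
    refine ⟨Pi.single ⟨y, hy⟩ (D.gen _), ?_⟩
    rw [cover, LinearMap.sum_apply, Finset.sum_eq_single ⟨y, hy⟩]
    · simpa using hc y hy
    · intro i _ hi
      simp [Pi.single_eq_of_ne hi]
    · simp
  · intro p hp i
    by_contra hi
    obtain ⟨w, hw, -⟩ := D.exists_mul_eq (p i).2 hi
    have hx : (i : N) ∈ Submodule.span R ((s.erase i : Finset N) : Set N) := by
      have h0 : ∑ j, (p j : R) • (j : N) = 0 := by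
        rw [← D.cover_apply (fun x : s => c x.1 x.2) (fun x => (x : N))]; exact hp
      rw [← Finset.add_sum_erase _ _ (Finset.mem_univ i)] at h0
      have h1 : (i : N) =
          -((w * D.e (c i.1 i.2)) • ∑ j ∈ Finset.univ.erase i, (p j : R) • (j : N)) := by
        rw [← sub_eq_zero, sub_neg_eq_add]
        have := congrArg (fun z => (w * D.e (c i.1 i.2)) • z) h0
        simp only [smul_add, smul_zero] at this
        rwa [← mul_smul, mul_assoc, hw, hc _ i.2] at this
      refine (congrArg (· ∈ _) h1).mpr
        (Submodule.neg_mem _ (Submodule.smul_mem _ _ (Submodule.sum_mem _ fun j hj => ?_)))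
      refine Submodule.smul_mem _ _ (Submodule.subset_span ?_)
      have : (j : N) ≠ i := fun h => (Finset.mem_erase.1 hj).1 (Subtype.ext h)
      exact Finset.mem_coe.2 (Finset.mem_erase.2 ⟨this, j.2⟩)
    refine hmin (s.erase i) ⟨fun x hx => ⟨_, hc x (Finset.mem_of_mem_erase hx)⟩, ?_⟩
      (Finset.card_erase_lt_of_mem i.2)
    rw [eq_top_iff, ← hspan, Submodule.span_le]
    intro y hy
    by_cases hyi : y = i
    · rw [hyi]; exact hx
    · exact Submodule.subset_span (by simp [hyi, Finset.mem_coe.1 hy])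

/-- The quotient of `R e_v` by the left ideal `L ∩ R e_v`. -/
abbrev Q (v : V) (L : Ideal R) : Type := D.P v ⧸ Submodule.comap (D.P v).subtype L

/-- The canonical projection of `R e_v` onto its quotient `D.Q v L`. -/
def toQ (v : V) (L : Ideal R) : D.P v →ₗ[R] D.Q v L := Submodule.mkQ _

theorem toQ_surjective (v : V) (L : Ideal R) : Function.Surjective (D.toQ v L) :=
  Submodule.mkQ_surjective _

theorem toQ_eq_zero {v : V} {L : Ideal R} {p : D.P v} : D.toQ v L p = 0 ↔ (p : R) ∈ L := by
  simp [toQ]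

/-- The projective `R e_v` as the trivial quotient of itself. -/
def equivBot (v : V) : D.Q v ⊥ ≃ₗ[R] D.P v :=
  Submodule.quotEquivOfEqBot _ (by
    rw [← LinearMap.ker]; exact (D.P v).ker_subtype)

instance projective_Q_bot (v : V) : Module.Projective R (D.Q v ⊥) :=
  Module.Projective.of_equiv (D.equivBot v).symm

theorem isIndec_Q {v : V} {L : Ideal R} (h : D.e v ∉ L) : IsIndecModule R (D.Q v L) := by
  have hg : D.toQ v L (D.gen v) ≠ 0 := fun h0 => h (D.toQ_eq_zero.1 h0)
  have key : ∀ A : Submodule R (D.Q v L), A ≠ ⊤ → ∀ p : D.P v, D.toQ v L p ∈ A → (p : R) ∈ D.J := by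
    intro A hA p hp
    by_contra hJ
    obtain ⟨w, hw, -⟩ := D.exists_mul_eq p.2 hJ
    apply hA
    have h1 : D.toQ v L (D.gen v) ∈ A := by
      have : D.gen v = (w * D.e v) • p := Subtype.ext (by simp [mul_assoc, hw])
      rw [this, map_smul]
      exact A.smul_mem _ hp
    rw [eq_top_iff]
    intro x _
    obtain ⟨q, rfl⟩ := D.toQ_surjective v L x
    rw [← D.smul_gen q, map_smul]
    exact A.smul_mem _ h1
  refine ⟨⟨_, 0, hg⟩, fun A B hAB => ?_⟩
  by_cases hA : A = ⊤
  · exact Or.inr (by simpa [hA] using hAB.inf_eq_bot)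
  by_cases hB : B = ⊤
  · exact Or.inl (by simpa [hB] using hAB.inf_eq_bot)
  exfalso
  have htop : D.toQ v L (D.gen v) ∈ A ⊔ B := by rw [hAB.sup_eq_top]; trivial
  obtain ⟨a, ha, b, hb, hab⟩ := Submodule.mem_sup.1 htop
  obtain ⟨p, rfl⟩ := D.toQ_surjective v L a
  obtain ⟨q, rfl⟩ := D.toQ_surjective v L b
  have hpq : D.toQ v L (D.gen v - (p + q)) = 0 := by rw [map_sub, map_add, hab, sub_self]
  have hs : (p : R) + q ∈ D.J := D.J.add_mem (key A hA p ha) (key B hB q hb)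
  have hnil := D.isNilpotent_of_mem hs
  obtain ⟨z, hz⟩ := hnil.isUnit_one_sub
  have h2 : (z : R) * D.e v ∈ L := by
    rw [hz, sub_mul, one_mul, add_mul, D.coe_mul_e, D.coe_mul_e]
    simpa using D.toQ_eq_zero.1 hpq
  have := L.mul_mem_left (↑z⁻¹ : R) h2
  rw [← mul_assoc, Units.inv_mul, one_mul] at this
  exact h this

theorem isIndec_Q_of_le {v : V} {L : Ideal R} (h : L ≤ D.J) : IsIndecModule R (D.Q v L) :=
  D.isIndec_Q fun h' => D.e_notMem v (h h')

section Classification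

variable {ι : Type} [Fintype ι] {c : ι → V} {x : ι → N}

/-- If the coordinates of the kernel of a cover lie in `I`, then `N` surjects onto `D.Q v I`. -/
theorem exists_surjective_Q (hsurj : Function.Surjective (D.cover c x)) {I : Ideal R}
    (hI : ∀ p ∈ LinearMap.ker (D.cover c x), ∀ i, (p i : R) ∈ I) (i : ι) :
    ∃ π : N →ₗ[R] D.Q (c i) I, Function.Surjective π := by
  let f : (∀ i, D.P (c i)) →ₗ[R] D.Q (c i) I := D.toQ _ _ ∘ₗ LinearMap.proj i
  have hf : LinearMap.ker (D.cover c x) ≤ LinearMap.ker f := fun p hp => by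
    rw [LinearMap.mem_ker]
    exact D.toQ_eq_zero.2 (hI p hp i)
  refine ⟨(LinearMap.ker (D.cover c x)).liftQ f hf ∘ₗ
    ((D.cover c x).quotKerEquivOfSurjective hsurj).symm.toLinearMap, ?_⟩
  have hfs : Function.Surjective f :=
    (D.toQ_surjective _ _).comp (LinearMap.proj_surjective (R := R) i)
  have : Function.Surjective ((LinearMap.ker (D.cover c x)).liftQ f hf) := by
    rw [← LinearMap.range_eq_top, Submodule.range_liftQ, LinearMap.range_eq_top]
    exact hfs
  exact this.comp (LinearEquiv.surjective _)

/-- The obstruction to splitting: a socle element `a` of `D.Q (c i) I` at a vertex `v` in the top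
of the kernel of the cover. -/
theorem false_of_socle (hN : SplitsOver R N N) (hsurj : Function.Surjective (D.cover c x))
    {I : Ideal R} (hIr : ∀ y ∈ I, ∀ r, y * r ∈ I)
    (hI : ∀ p ∈ LinearMap.ker (D.cover c x), ∀ i, (p i : R) ∈ I) {v : V}
    (k : LinearMap.ker (D.cover c x))
    (hk : D.e v • (k : ∀ i, D.P (c i)) ∉ D.J • LinearMap.ker (D.cover c x))
    (i : ι) (a : D.P (c i)) (ha : (a : R) ∉ I) (hva : D.e v * (a : R) = a)
    (hJa : ∀ y ∈ D.J, y * (a : R) ∈ I) : False := by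
  classical
  obtain ⟨π, hπ⟩ := D.exists_surjective_Q hsurj hI i
  obtain ⟨φ, hφ⟩ := D.exists_hom_ne_zero (X := D.Q (c i) I) k hk (s := D.toQ _ _ a)
    (by rw [← map_smul]; congr 1; exact Subtype.ext hva)
    (fun h0 => ha (D.toQ_eq_zero.1 h0))
    (fun y hy => by rw [← map_smul, toQ_eq_zero]; exact hJa y hy)
  obtain ⟨ψ, hψ⟩ := hN.exists_extension _ hsurj π hπ φ
  apply hφ
  rw [← hψ, D.apply_eq_sum]
  refine Finset.sum_eq_zero fun j _ => ?_
  obtain ⟨q, hq⟩ := D.toQ_surjective _ _ (ψ (Pi.single j (D.gen (c j))))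
  rw [← hq, ← map_smul, toQ_eq_zero]
  exact hIr _ (hI k k.2 j) _

/-- The top of the kernel of a projective cover of a rigid module is disjoint from the top of the
module. -/
theorem e_smul_mem (hN : SplitsOver R N N) (hsurj : Function.Surjective (D.cover c x))
    (hI : ∀ p ∈ LinearMap.ker (D.cover c x), ∀ i, (p i : R) ∈ D.J)
    (k : LinearMap.ker (D.cover c x)) (i : ι) :
    D.e (c i) • (k : ∀ i, D.P (c i)) ∈ D.J • LinearMap.ker (D.cover c x) := by
  by_contra hk
  exact D.false_of_socle hN hsurj D.mul_mem_right hI k hk i (D.gen _) (D.e_notMem _)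
    (D.mul_self _) fun y hy => D.mul_mem_right _ hy _

theorem exists_e_smul_notMem_of_ne_bot {A : Submodule R N} (h : A ≠ ⊥) :
    ∃ (v : V) (k : A), D.e v • (k : N) ∉ D.J • A := by
  by_contra! h'
  refine h (le_bot_iff.1 (D.le_of_le_sup_smul (B := ⊥) ?_))
  intro k hk
  rw [bot_sup_eq, ← D.sum_smul k]
  exact Submodule.sum_mem _ fun v _ => h' v ⟨k, hk⟩

theorem exists_equiv_of_ker_eq_bot (hind : IsIndecModule R N)
    (hsurj : Function.Surjective (D.cover c x)) (hker : LinearMap.ker (D.cover c x) = ⊥) :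
    ∃ v, Nonempty (N ≃ₗ[R] D.Q v ⊥) := by
  classical
  let e := (LinearEquiv.ofBijective (D.cover c x) ⟨LinearMap.ker_eq_bot.1 hker, hsurj⟩).symm
  have hne := hind.1
  have hι : Nonempty ι := by
    by_contra hι
    rw [not_nonempty_iff] at hι
    obtain ⟨y, hy⟩ := exists_ne (0 : N)
    exact hy (e.injective (Subsingleton.elim _ _))
  obtain ⟨i⟩ := hι
  have : Nontrivial (D.P (c i)) :=
    ⟨D.gen _, 0, fun h => D.e_ne (c i) (congrArg Subtype.val h)⟩
  exact ⟨c i, ⟨LinearEquiv.ofBijective _ (hind.equiv_factor e i) ≪≫ₗ (D.equivBot _).symm⟩⟩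

end Classification

theorem exists_equiv_of_projective [Module.Finite R N] [Module.Projective R N]
    (hind : IsIndecModule R N) : ∃ v, Nonempty (N ≃ₗ[R] D.Q v ⊥) := by
  classical
  obtain ⟨ι, _, c, x, hsurj, hI⟩ := D.exists_cover (N := N)
  refine D.exists_equiv_of_ker_eq_bot hind hsurj ?_
  obtain ⟨s, hs⟩ := Module.projective_lifting_property (D.cover c x) LinearMap.id hsurj
  have hA : LinearMap.ker (D.cover c x) ≤ ⊥ ⊔ D.J • LinearMap.ker (D.cover c x) := by
    intro k hk
    rw [bot_sup_eq]
    let q : (∀ i, D.P (c i)) →ₗ[R] (∀ i, D.P (c i)) := LinearMap.id - s ∘ₗ D.cover c x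
    have hq : ∀ z, q z ∈ LinearMap.ker (D.cover c x) := fun z => by
      have := LinearMap.congr_fun hs (D.cover c x z)
      simp only [LinearMap.comp_apply, LinearMap.id_apply] at this
      simp [q, this]
    have hqk : q k = k := by simp [q, LinearMap.mem_ker.1 hk]
    rw [← hqk, D.apply_eq_sum]
    exact Submodule.sum_mem _ fun i _ => Submodule.smul_mem_smul (hI k hk i) (hq _)
  exact le_bot_iff.1 (D.le_of_le_sup_smul hA)

end BasicData

/-- Basic data with two vertices, where the arrows `m j` generate the off-diagonal part of the
algebra from both sides. -/
structure TwoVertex (K : Type) [Field K] (R : Type) [Ring R] [Algebra K R] extends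
    BasicData K Bool R where
  m : Bool → R
  e_mul_m : ∀ j, e (!j) * m j = m j
  m_mul_e : ∀ j, m j * e j = m j
  m_left : ∀ j r, ∃ a, e (!j) * r * e j = a * m j
  m_right : ∀ j r, ∃ b, e (!j) * r * e j = m j * b
  I : Ideal R
  mul_mem_I : ∀ x ∈ J, ∀ y ∈ J, x * y ∈ I
  I_mul : ∀ y ∈ I, ∀ r, y * r ∈ I
  m_notMem : ∀ j, m j ∉ I

namespace TwoVertex

variable {K : Type} [Field K] {R : Type} [Ring R] [Algebra K R] (T : TwoVertex K R)
  {N : Type} [AddCommGroup N] [Module R N]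

theorem e_add_e (j : Bool) : T.e j + T.e (!j) = 1 := by
  rw [← T.sum_e]
  cases j <;> simp [add_comm]

theorem m_mem_J (j : Bool) : T.m j ∈ T.J := by
  rw [← T.m_mul_e j, ← T.e_mul_m j]
  exact T.off_diag (by simp) _

theorem m_mem_P (j : Bool) : T.m j ∈ T.P j := T.mem_P.2 (T.m_mul_e j)

/-- The left ideals defining the indecomposable rigid modules. -/
def L (q : Bool × Bool) : Ideal R := bif q.2 then Ideal.span {T.m q.1} else ⊥

theorem L_le (q : Bool × Bool) : T.L q ≤ T.J := by
  obtain ⟨j, _ | _⟩ := q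
  · exact bot_le
  · exact (Ideal.span_singleton_le_iff_mem _).2 (T.m_mem_J j)

/-- The indecomposable rigid modules: `R e_j` and `R e_j / R m_j`. -/
abbrev Qq (q : Bool × Bool) : Type := T.Q q.1 (T.L q)

theorem isIndec_Qq (q : Bool × Bool) : IsIndecModule R (T.Qq q) := T.isIndec_Q_of_le (T.L_le q)

/-- Indecomposable rigid modules are among the `Qq`. -/
theorem exists_equiv_Qq [Module.Finite R N] (hind : IsIndecModule R N)
    (hN : SplitsOver R N N) : ∃ q, Nonempty (N ≃ₗ[R] T.Qq q) := by
  classical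
  obtain ⟨ι, _, c, x, hsurj, hJ⟩ := T.exists_cover (N := N)
  by_cases hker : LinearMap.ker (T.cover c x) = ⊥
  · obtain ⟨v, hv⟩ := T.exists_equiv_of_ker_eq_bot hind hsurj hker
    exact ⟨(v, false), hv⟩
  obtain ⟨v, k, hk⟩ := T.exists_e_smul_notMem_of_ne_bot hker
  obtain ⟨j, rfl⟩ : ∃ j, v = !j := ⟨!v, by simp⟩
  have hc : ∀ i, c i = j := fun i => by
    by_contra h
    have : c i = !j := by rw [Bool.eq_not]; exact h
    exact hk (this ▸ T.e_smul_mem hN hsurj hJ k i)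
  obtain rfl : c = fun _ => j := funext hc
  replace hk : T.e (!j) • (k : ι → T.P j) ∉ T.J • LinearMap.ker (T.cover (fun _ => j) x) := hk
  obtain ⟨i₁⟩ : Nonempty ι := by
    by_contra hι
    rw [not_nonempty_iff] at hι
    exact hk (by rw [Subsingleton.elim (T.e (!j) • (k : ι → T.P j)) 0]; exact zero_mem _)
  let g := T.cover (fun _ : ι => j) x
  have hspan : ∀ p ∈ LinearMap.ker g, ∀ i, (p i : R) ∈ Ideal.span {T.m j} := by
    let B : Submodule R (ι → T.P j) :=
      Submodule.pi Set.univ fun _ => Submodule.comap (T.P j).subtype (Ideal.span {T.m j})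
    have hB : LinearMap.ker g ≤ B := by
      refine T.le_of_le_sup_smul fun p hp => ?_
      rw [← one_smul R p, ← T.e_add_e j, add_smul, add_comm]
      refine Submodule.add_mem_sup ?_ (T.e_smul_mem hN hsurj hJ ⟨p, hp⟩ i₁)
      rw [Submodule.mem_pi]
      intro i _
      obtain ⟨a, ha⟩ := T.m_left j (p i)
      refine Ideal.mem_span_singleton'.2 ⟨a, ?_⟩
      rw [← ha, mul_assoc, T.coe_mul_e]; rfl
    exact fun p hp i => Submodule.mem_pi.1 (hB hp) i trivial
  obtain ⟨p, hp, i₀, hpi⟩ : ∃ p ∈ LinearMap.ker g, ∃ i, (p i : R) ∉ T.I := by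
    by_contra! h
    exact T.false_of_socle hN hsurj T.I_mul h k hk i₁ ⟨T.m j, T.m_mem_P j⟩ (T.m_notMem j)
      (T.e_mul_m j) fun y hy => T.mul_mem_I y hy _ (T.m_mem_J j)
  have hpi' : T.e (!j) * (p i₀ : R) ∉ T.I := by
    intro h
    apply hpi
    rw [← one_mul (p i₀ : R), ← T.e_add_e j, add_mul]
    refine T.I.add_mem ?_ h
    obtain ⟨r, hr⟩ := Ideal.mem_span_singleton'.1 (hspan p hp i₀)
    rw [← hr, ← T.e_mul_m, ← mul_assoc, ← mul_assoc]
    exact T.mul_mem_I _ (T.off_diag (by simp) r) _ (T.m_mem_J j)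
  choose b hb using fun i => T.m_right j (p i : R)
  let u : ι → T.P j := fun i => ⟨T.e j * b i * T.e j, T.mem_P.2 (by rw [mul_assoc, T.mul_self])⟩
  have hu : T.m j • u = T.e (!j) • p := by
    funext i
    apply Subtype.ext
    have h1 : T.m j * (T.e j * b i * T.e j) = T.e (!j) * (p i : R) := by
      rw [← mul_assoc, ← mul_assoc, T.m_mul_e, ← hb, mul_assoc, T.mul_self, mul_assoc,
        T.coe_mul_e]
    exact h1
  have hgu : T.m j • g u = 0 := by
    rw [← map_smul, hu, map_smul, LinearMap.mem_ker.1 hp, smul_zero]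
  have hε : T.e j * b i₀ * T.e j ∉ T.J := by
    intro h
    apply hpi'
    have := congrArg (fun z : ι → T.P j => (z i₀ : R)) hu
    have h2 : T.m j * (T.e j * b i₀ * T.e j) = T.e (!j) * (p i₀ : R) := this
    rw [← h2]
    exact T.mul_mem_I _ (T.m_mem_J j) _ h
  obtain ⟨w, hw, hw'⟩ := T.exists_inv hε
  obtain ⟨a', ha'⟩ := T.m_left j (T.m j * w)
  rw [← mul_assoc, T.e_mul_m] at ha'
  have heu : T.e j • u = u := by
    funext i
    apply Subtype.ext
    have : T.e j * (T.e j * b i * T.e j) = T.e j * b i * T.e j := by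
      rw [← mul_assoc, ← mul_assoc, T.mul_self]
    exact this
  have hmem : ∀ r, r * (T.e j * b i₀ * T.e j) ∈ Ideal.span {T.m j} →
      r * T.e j ∈ Ideal.span {T.m j} := by
    intro r hr
    obtain ⟨a, ha⟩ := Ideal.mem_span_singleton'.1 hr
    refine Ideal.mem_span_singleton'.2 ⟨a * a', ?_⟩
    rw [mul_assoc, ← ha', ← mul_assoc, ← mul_assoc, ha, mul_assoc r, hw', mul_assoc,
      T.mul_self]
  have hzero : ∀ r, r * T.e j ∈ Ideal.span {T.m j} → r • g u = 0 := by
    intro r hr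
    obtain ⟨a, ha⟩ := Ideal.mem_span_singleton'.1 hr
    rw [← heu, map_smul, ← mul_smul, ← ha, mul_smul, hgu, smul_zero]
  let N₁ : Submodule R N := Submodule.span R {g u}
  let N₂ : Submodule R N := Submodule.map g (LinearMap.ker (LinearMap.proj i₀))
  have hcompl : IsCompl N₁ N₂ := by
    refine IsCompl.of_le ?_ ?_
    · rintro y ⟨h1, p', hp', rfl⟩
      obtain ⟨r, hr⟩ := Submodule.mem_span_singleton.1 h1
      have h0 : p' i₀ = 0 := hp'
      have h2 : r • u - p' ∈ LinearMap.ker g := by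
        rw [LinearMap.mem_ker, map_sub, map_smul, hr, sub_self]
      have h3 := hspan _ h2 i₀
      have h4 : ((r • u - p') i₀ : R) = r * (T.e j * b i₀ * T.e j) := by
        simp [h0, u]
      rw [h4] at h3
      rw [← hr, Submodule.mem_bot]
      exact hzero r (hmem r h3)
    · intro y _
      obtain ⟨p', rfl⟩ := hsurj y
      rw [← sub_add_cancel p' (((p' i₀ : R) * w) • u), map_add, map_smul, add_comm]
      refine Submodule.add_mem_sup
        (Submodule.smul_mem _ _ (Submodule.mem_span_singleton_self _)) ?_
      refine Submodule.mem_map_of_mem ?_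
      rw [LinearMap.mem_ker]
      apply Subtype.ext
      have : (p' i₀ : R) - (p' i₀ : R) * w * (T.e j * b i₀ * T.e j) = 0 := by
        rw [mul_assoc, hw, T.coe_mul_e, sub_self]
      exact this
  have htop : N₁ = ⊤ := by
    rcases hind.2 _ _ hcompl with h | h
    · exfalso
      have : g u = 0 := by
        have := Submodule.mem_span_singleton_self (R := R) (g u)
        change g u ∈ N₁ at this
        rwa [h, Submodule.mem_bot] at this
      exact hε (hJ u this i₀)
    · simpa [h] using hcompl.sup_eq_top
  have hls : Function.Surjective (T.lift j (g u)) := by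
    intro y
    have hy : y ∈ N₁ := by rw [htop]; trivial
    obtain ⟨r, rfl⟩ := Submodule.mem_span_singleton.1 hy
    refine ⟨r • T.gen j, ?_⟩
    rw [map_smul, BasicData.lift_apply, BasicData.coe_gen, ← map_smul, heu]
  have hlk : LinearMap.ker (T.lift j (g u)) =
      Submodule.comap (T.P j).subtype (Ideal.span {T.m j}) := by
    ext r
    rw [LinearMap.mem_ker, BasicData.lift_apply, Submodule.mem_comap]
    constructor
    · intro hr
      have h2 : (r : R) • u ∈ LinearMap.ker g := by rw [LinearMap.mem_ker, map_smul, hr]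
      have := hmem r (hspan _ h2 i₀)
      rwa [T.coe_mul_e] at this
    · intro hr
      exact hzero r (by rwa [T.coe_mul_e])
  exact ⟨(j, true), ⟨((T.lift j (g u)).quotKerEquivOfSurjective hls).symm ≪≫ₗ
    Submodule.quotEquivOfEq _ _ hlk⟩⟩

end TwoVertex

section Finiteness

variable {Λ : Type} [Ring Λ]

/-- A basic support τ-tilting module is a finite product of indecomposable rigid modules. -/
theorem IsBasicSupportTauTilting.exists_finset {κ : Type} [DecidableEq κ] {Q : κ → Type}
    [∀ i, AddCommGroup (Q i)] [∀ i, Module Λᵐᵒᵖ (Q i)]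
    (hQ : ∀ (N : Type) [AddCommGroup N] [Module Λᵐᵒᵖ N], Module.Finite Λᵐᵒᵖ N →
      IsIndecModule Λᵐᵒᵖ N → SplitsOver Λᵐᵒᵖ N N → ∃ a, Nonempty (N ≃ₗ[Λᵐᵒᵖ] Q a))
    {M : RMod Λ} (hM : IsBasicSupportTauTilting Λ M) :
    ∃ S : Finset κ, Nonempty (M ≃ₗ[Λᵐᵒᵖ] (∀ q : S, Q q)) := by
  refine hM.2.exists_finset fun A p hp hA => hQ A ?_ hA ?_
  · have := hM.1.1.1
    exact Module.Finite.of_surjective p fun x => ⟨x, LinearMap.congr_fun hp x⟩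
  · exact (hM.1.1.splitsOver.of_retract A.subtype p hp).of_surjective p
      fun x => ⟨x, LinearMap.congr_fun hp x⟩

theorem isTauTiltingFinite_of_indec {κ : Type} [Fintype κ] [DecidableEq κ] {Q : κ → Type}
    [∀ i, AddCommGroup (Q i)] [∀ i, Module Λᵐᵒᵖ (Q i)]
    (hQ : ∀ (N : Type) [AddCommGroup N] [Module Λᵐᵒᵖ N], Module.Finite Λᵐᵒᵖ N →
      IsIndecModule Λᵐᵒᵖ N → SplitsOver Λᵐᵒᵖ N N → ∃ a, Nonempty (N ≃ₗ[Λᵐᵒᵖ] Q a)) :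
    IsTauTiltingFinite Λ := by
  refine ⟨_, fun i => ModuleCat.of Λᵐᵒᵖ
    (∀ q : ((Fintype.equivFin (Finset κ)).symm i : Finset κ), Q q), fun M hM => ?_⟩
  obtain ⟨S, ⟨e⟩⟩ := hM.exists_finset hQ
  refine ⟨Fintype.equivFin _ S, ?_⟩
  beta_reduce
  rw [Equiv.symm_apply_apply]
  exact ⟨e⟩

theorem FacLE.of_surjective {M N : RMod Λ} {ι : Type} [Fintype ι] (f : (ι → N) →ₗ[Λᵐᵒᵖ] M)
    (hf : Function.Surjective f) : FacLE Λ M N := by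
  classical
  rintro X ⟨k, g, hg⟩
  let t : Fin (Fintype.card (Fin k × ι)) ≃ Fin k × ι := (Fintype.equivFin _).symm
  refine ⟨_, g ∘ₗ LinearMap.pi (fun i => f ∘ₗ LinearMap.pi fun j => LinearMap.proj (t.symm (i, j))),
    hg.comp fun y => ?_⟩
  choose z hz using fun i => hf (y i)
  refine ⟨fun a => z (t a).1 (t a).2, ?_⟩
  funext i
  rw [← hz i]
  simp only [LinearMap.pi_apply, LinearMap.comp_apply]
  congr 1
  funext j
  simp

theorem FacLE.exists_surjective {M N : RMod Λ} (h : FacLE Λ M N) :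
    ∃ (k : ℕ) (f : (Fin k → N) →ₗ[Λᵐᵒᵖ] M), Function.Surjective f :=
  h M ⟨1, LinearMap.proj 0, LinearMap.proj_surjective (R := Λᵐᵒᵖ) 0⟩

end Finiteness

namespace BasicData

variable {K : Type} [Field K] {V : Type} [Fintype V] [DecidableEq V]
  {R : Type} [Ring R] [Algebra K R] (D : BasicData K V R)
  {N X : Type} [AddCommGroup N] [Module R N] [AddCommGroup X] [Module R X]

/-- The top of the module `X` does not contain the simple module at `v`. -/
def TopAvoids (v : V) (X : Type) [AddCommGroup X] [Module R X] : Prop :=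
  ∀ x : X, D.e v • x ∈ D.J • (⊤ : Submodule R X)

/-- The module `X` is not supported at `v`. -/
def Avoids (v : V) (X : Type) [AddCommGroup X] [Module R X] : Prop := ∀ x : X, D.e v • x = 0

variable {D} {v : V}

theorem TopAvoids.of_surjective (h : D.TopAvoids v N) (f : N →ₗ[R] X)
    (hf : Function.Surjective f) : D.TopAvoids v X := by
  intro x
  obtain ⟨n, rfl⟩ := hf x
  rw [← map_smul]
  have := Submodule.mem_map_of_mem (f := f) (h n)
  rw [Submodule.map_smul''] at this
  exact Submodule.smul_mono le_rfl le_top this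

theorem Avoids.of_surjective (h : D.Avoids v N) (f : N →ₗ[R] X)
    (hf : Function.Surjective f) : D.Avoids v X := by
  intro x
  obtain ⟨n, rfl⟩ := hf x
  rw [← map_smul, h n, map_zero]

theorem TopAvoids.pi {ι : Type} [Fintype ι] {Y : ι → Type} [∀ i, AddCommGroup (Y i)]
    [∀ i, Module R (Y i)] (h : ∀ i, D.TopAvoids v (Y i)) : D.TopAvoids v (∀ i, Y i) := by
  classical
  intro x
  rw [← Finset.univ_sum_single x, Finset.smul_sum]
  refine Submodule.sum_mem _ fun i _ => ?_
  have := Submodule.mem_map_of_mem (f := LinearMap.single R Y i) (h i (x i))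
  rw [Submodule.map_smul''] at this
  have := Submodule.smul_mono le_rfl le_top this
  rwa [map_smul, LinearMap.single_apply] at this

theorem Avoids.pi {ι : Type} {Y : ι → Type} [∀ i, AddCommGroup (Y i)]
    [∀ i, Module R (Y i)] (h : ∀ i, D.Avoids v (Y i)) : D.Avoids v (∀ i, Y i) :=
  fun x => funext fun i => h i (x i)

variable (D)

theorem topAvoids_Q {v w : V} (h : w ≠ v) (L : Ideal R) : D.TopAvoids v (D.Q w L) := by
  intro x
  obtain ⟨p, rfl⟩ := D.toQ_surjective w L x
  have : D.e v • p = (D.e v * p * D.e w) • D.gen w := by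
    apply Subtype.ext
    simp [mul_assoc]
  rw [← map_smul, this, map_smul]
  exact Submodule.smul_mem_smul (D.off_diag h.symm _) trivial

theorem J_smul_Q (w : V) {y : R} (hy : y ∈ D.J) (x : D.Q w D.J) : y • x = 0 := by
  obtain ⟨p, rfl⟩ := D.toQ_surjective w _ x
  rw [← map_smul, toQ_eq_zero]
  exact D.mul_mem_right _ hy _

/-- The canonical homomorphism between quotients of `R e_v`. -/
def factor (v : V) {L L' : Ideal R} (h : L ≤ L') : D.Q v L →ₗ[R] D.Q v L' :=
  Submodule.factor (Submodule.comap_mono h)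

theorem factor_surjective (v : V) {L L' : Ideal R} (h : L ≤ L') :
    Function.Surjective (D.factor v h) := Submodule.factor_surjective (Submodule.comap_mono h)

theorem not_topAvoids_Q (v : V) {L : Ideal R} (hL : L ≤ D.J) : ¬ D.TopAvoids v (D.Q v L) := by
  intro h
  have h1 := h.of_surjective _ (D.factor_surjective v hL) (D.toQ v D.J (D.gen v))
  have h2 : D.J • (⊤ : Submodule R (D.Q v D.J)) ≤ ⊥ :=
    Submodule.smul_le.2 fun y hy x _ => D.J_smul_Q v hy x
  have h3 := h2 h1
  rw [Submodule.mem_bot, ← map_smul, toQ_eq_zero] at h3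
  refine D.e_notMem v ?_
  simpa [D.mul_self] using h3

end BasicData

namespace TwoVertex

variable {K : Type} [Field K] {R : Type} [Ring R] [Algebra K R] (T : TwoVertex K R)

theorem topAvoids_Qq {v : Bool} {q : Bool × Bool} : T.TopAvoids v (T.Qq q) ↔ q.1 ≠ v :=
  ⟨fun h hq => T.not_topAvoids_Q v (T.L_le q) (hq ▸ h), fun h => T.topAvoids_Q h _⟩

theorem avoids_Qq {v : Bool} {q : Bool × Bool} : T.Avoids v (T.Qq q) ↔ q = (!v, true) := by
  constructor
  · intro h
    obtain ⟨j, b⟩ := q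
    by_cases hj : j = v
    · subst hj
      have h1 := h (T.toQ _ _ (T.gen _))
      rw [← map_smul, BasicData.toQ_eq_zero] at h1
      have h2 := T.L_le _ h1
      exact absurd (by simpa [T.mul_self] using h2) (T.e_notMem j)
    · obtain rfl : j = !v := by rw [Bool.eq_not]; exact hj
      cases b
      · have h1 := h (T.toQ _ _ ⟨T.m (!v), T.m_mem_P _⟩)
        rw [← map_smul, BasicData.toQ_eq_zero] at h1
        have h2 := T.e_mul_m (!v)
        rw [Bool.not_not] at h2
        have h3 : T.e v * T.m (!v) = 0 := h1
        rw [h2] at h3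
        exact absurd (h3 ▸ T.I.zero_mem) (T.m_notMem (!v))
      · rfl
  · rintro rfl x
    obtain ⟨p, rfl⟩ := T.toQ_surjective _ _ x
    rw [← map_smul, BasicData.toQ_eq_zero]
    obtain ⟨a, ha⟩ := T.m_left (!v) p
    refine Ideal.mem_span_singleton'.2 ⟨a, ?_⟩
    rw [← ha, Bool.not_not, mul_assoc, T.coe_mul_e]
    rfl

theorem eq_of_Qq_equiv {q q' : Bool × Bool} (e : T.Qq q ≃ₗ[R] T.Qq q') : q = q' := by
  have h1 : ∀ v, q.1 ≠ v ↔ q'.1 ≠ v := fun v => by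
    rw [← topAvoids_Qq T, ← topAvoids_Qq T]
    exact ⟨fun h => h.of_surjective e.toLinearMap e.surjective,
      fun h => h.of_surjective e.symm.toLinearMap e.symm.surjective⟩
  have h2 : ∀ v, q = (!v, true) ↔ q' = (!v, true) := fun v => by
    rw [← avoids_Qq T, ← avoids_Qq T]
    exact ⟨fun h => h.of_surjective e.toLinearMap e.surjective,
      fun h => h.of_surjective e.symm.toLinearMap e.symm.surjective⟩
  revert h1 h2
  clear e
  revert q q'
  decide

/-- The product of the modules `Qq q` over a finite set. -/
def LS (S : Finset (Bool × Bool)) : ModuleCat.{0} R := ModuleCat.of R (∀ q : S, T.Qq q)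

theorem topAvoids_LS {v : Bool} {S : Finset (Bool × Bool)} :
    T.TopAvoids v (T.LS S) ↔ ∀ q ∈ S, q.1 ≠ v := by
  constructor
  · intro h q hq
    rw [← T.topAvoids_Qq]
    exact h.of_surjective (LinearMap.proj (⟨q, hq⟩ : S) : (∀ q : S, T.Qq q) →ₗ[R] _)
      (LinearMap.proj_surjective (R := R) _)
  · intro h
    exact BasicData.TopAvoids.pi fun q : S => T.topAvoids_Qq.2 (h q q.2)

theorem avoids_LS {v : Bool} {S : Finset (Bool × Bool)} :
    T.Avoids v (T.LS S) ↔ ∀ q ∈ S, q = (!v, true) := by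
  constructor
  · intro h q hq
    rw [← avoids_Qq T]
    exact h.of_surjective (LinearMap.proj (⟨q, hq⟩ : S) : (∀ q : S, T.Qq q) →ₗ[R] _)
      (LinearMap.proj_surjective (R := R) _)
  · intro h
    exact BasicData.Avoids.pi fun q : S => T.avoids_Qq.2 (h q q.2)

theorem L_mono {j b b' : Bool} (h : b = true → b' = true) : T.L (j, b) ≤ T.L (j, b') := by
  cases b
  · exact bot_le
  · rw [h rfl]

instance finite_LS (S : Finset (Bool × Bool)) : Module.Finite R (T.LS S) :=
  inferInstanceAs (Module.Finite R (∀ q : S, T.Qq q))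

theorem projective_LS {S : Finset (Bool × Bool)} (hS : ∀ q ∈ S, q.2 = false) :
    Module.Projective R (T.LS S) := by
  have : ∀ q : S, Module.Projective R (T.Qq q) := by
    rintro ⟨⟨j, b⟩, hq⟩
    obtain rfl : b = false := hS _ hq
    exact T.projective_Q_bot j
  exact Module.Projective.of_equiv
    (DFinsupp.linearEquivFunOnFintype : (Π₀ q : S, T.Qq q) ≃ₗ[R] ∀ q : S, T.Qq q)

end TwoVertex

theorem HasIndecClassCount.le_one {R : Type} [Ring R] {M : ModuleCat.{0} R} {n : ℕ}
    (h : HasIndecClassCount R M n) (hM : IsIndecModule R M) : n ≤ 1 := by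
  obtain ⟨k, A, hA, hind, c, hc, -⟩ := h
  have hsub : ∀ i j : Fin k, i = j := by
    intro i j
    by_contra hij
    have := (hind i).1
    have := (hind j).1
    obtain ⟨y, hy⟩ := exists_ne (0 : A i)
    have hinj := (hM.equiv_factor (internalEquiv hA) j).1
    have h0 : (internalEquiv hA).symm (Pi.single i y) = 0 := hinj (by
      simp [Pi.single_eq_of_ne (Ne.symm hij)])
    rw [LinearEquiv.map_eq_zero_iff, Pi.single_eq_zero_iff] at h0
    exact hy h0
  have hk : k ≤ 1 := by
    by_contra hk
    exact absurd (hsub ⟨0, by omega⟩ ⟨1, by omega⟩) (by simp)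
  have := Fintype.card_le_of_surjective c hc
  simp only [Fintype.card_fin] at this
  omega

namespace TwoVertex

section Ring

variable {K : Type} [Field K] {R : Type} [Ring R] [Algebra K R] (T : TwoVertex K R)

theorem card_classes_LS (S : Finset (Bool × Bool)) :
    HasIndecClassCount R (T.LS S) S.card := by
  have := hasIndecClassCount_of_equiv (M := T.LS S) (Q := fun q : S => T.Qq q)
    (LinearEquiv.refl R _) (fun q => T.isIndec_Qq q) (fun i j h => by
      obtain ⟨e⟩ := h
      exact Subtype.ext (T.eq_of_Qq_equiv e))
  rwa [Fintype.card_coe] at this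

theorem isBasic_LS (S : Finset (Bool × Bool)) : IsBasicModuleCat R (T.LS S) :=
  isBasicModuleCat_of_equiv (M := T.LS S) (Q := fun q : S => T.Qq q)
    (LinearEquiv.refl R _) (fun q => T.isIndec_Qq q) (fun i j h => by
      obtain ⟨e⟩ := h
      exact Subtype.ext (T.eq_of_Qq_equiv e))

/-- The regular module is the sum of the two indecomposable projectives. -/
theorem exists_regularEquiv : Nonempty (R ≃ₗ[R] (∀ v, T.Q v ⊥)) := by
  let f : R →ₗ[R] (∀ v, T.Q v ⊥) :=
    LinearMap.pi fun v => LinearMap.toSpanSingleton R _ (T.toQ v ⊥ (T.gen v))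
  have hf : ∀ r v, f r v = T.toQ v ⊥ (r • T.gen v) := fun r v => by
    simp [f]
  refine ⟨LinearEquiv.ofBijective f ⟨?_, ?_⟩⟩
  · rw [← LinearMap.ker_eq_bot, LinearMap.ker_eq_bot']
    intro r hr
    have : ∀ v, r * T.e v = 0 := fun v => by
      have h := congrFun hr v
      rw [hf, Pi.zero_apply, BasicData.toQ_eq_zero] at h
      exact h
    rw [← mul_one r, ← T.sum_e, Finset.mul_sum]
    exact Finset.sum_eq_zero fun v _ => this v
  · intro z
    choose p hp using fun v => T.toQ_surjective v ⊥ (z v)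
    refine ⟨∑ w, (p w : R), funext fun v => ?_⟩
    rw [hf, ← hp]
    congr 1
    apply Subtype.ext
    have : (∑ w, (p w : R)) * T.e v = p v := by
      rw [Finset.sum_mul, Finset.sum_eq_single v]
      · exact T.coe_mul_e _
      · intro w _ hw
        rw [← T.coe_mul_e (p w), mul_assoc, T.mul_ne w v hw, mul_zero]
      · simp
    exact this

theorem card_classes_regular {K : Type} [Field K] {R : Type} [Ring R] [Algebra K R]
    (T : TwoVertex K R) :
    HasIndecClassCount R (ModuleCat.of R R) 2 := by
  obtain ⟨e⟩ := T.exists_regularEquiv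
  refine hasIndecClassCount_of_equiv (M := ModuleCat.of R R) (Q := fun v => T.Q v ⊥) e
    (fun v => T.isIndec_Q_of_le bot_le) fun v w h => ?_
  obtain ⟨t⟩ := h
  exact congrArg Prod.fst (T.eq_of_Qq_equiv (q := (v, false)) (q' := (w, false)) t)

theorem isTauRigid_LS_of_projective {S : Finset (Bool × Bool)} (hS : ∀ q ∈ S, q.2 = false) :
    IsTauRigidCat R (T.LS S) := by
  refine ⟨inferInstance, ModuleCat.of R PUnit, T.LS S, 0, LinearMap.id,
    inferInstanceAs (Module.Finite R PUnit), inferInstanceAs (Module.Projective R PUnit),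
    inferInstance, T.projective_LS hS, Function.surjective_id, ?_, fun h => ⟨0, ?_⟩⟩
  · rw [LinearMap.range_zero, LinearMap.ker_id]
  · ext x
    rw [Subsingleton.elim x 0, map_zero, map_zero]

theorem exists_m_smul {j : Bool} {q : Bool × Bool} (hq : q.1 = j) (y : T.Qq q) :
    ∃ y', T.e (!j) • y = T.m j • y' := by
  obtain ⟨i, c⟩ := q
  obtain rfl : i = j := hq
  obtain ⟨p, rfl⟩ := T.toQ_surjective _ _ y
  obtain ⟨b, hb⟩ := T.m_right i p
  refine ⟨b • T.toQ _ _ (T.gen _), ?_⟩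
  rw [← mul_smul, ← hb, ← map_smul, ← map_smul]
  congr 1
  apply Subtype.ext
  have : T.e (!i) * (p : R) = T.e (!i) * p * T.e i * T.e i := by
    rw [mul_assoc _ (T.e i), T.mul_self, mul_assoc, T.coe_mul_e]
  exact this

theorem isTauRigid_LS {S : Finset (Bool × Bool)} {j : Bool} (hj : (j, true) ∈ S)
    (hS : ∀ q ∈ S, q.1 = j) : IsTauRigidCat R (T.LS S) := by
  classical
  let q₀ : S := ⟨(j, true), hj⟩
  let f₀ : T.P (!j) →ₗ[R] T.P j := T.lift (!j) ⟨T.m j, T.m_mem_P j⟩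
  let f : T.P (!j) →ₗ[R] ∀ q : S, T.P q.1.1 :=
    LinearMap.single R (fun q : S => T.P q.1.1) q₀ ∘ₗ f₀
  let g : (∀ q : S, T.P q.1.1) →ₗ[R] ∀ q : S, T.Qq q :=
    LinearMap.pi fun q => T.toQ _ _ ∘ₗ LinearMap.proj q
  refine ⟨inferInstance, ModuleCat.of R (T.P (!j)), ModuleCat.of R (∀ q : S, T.P q.1.1), f, g,
    inferInstanceAs (Module.Finite R (T.P (!j))), inferInstanceAs (Module.Projective R (T.P (!j))),
    inferInstanceAs (Module.Finite R (∀ q : S, T.P q.1.1)),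
    Module.Projective.of_equiv (DFinsupp.linearEquivFunOnFintype :
      (Π₀ q : S, T.P q.1.1) ≃ₗ[R] ∀ q : S, T.P q.1.1), ?_, ?_, ?_⟩
  · intro y
    choose p hp using fun q : S => T.toQ_surjective _ _ (y q)
    exact ⟨p, funext hp⟩
  · ext x
    constructor
    · rintro ⟨p, rfl⟩
      refine LinearMap.mem_ker.2 (funext fun q => ?_)
      by_cases hq : q = q₀
      · subst hq
        refine T.toQ_eq_zero.2 ?_
        have : ((f p q₀ : T.P j) : R) = p * T.m j := by simp [f, f₀]
        change ((f p q₀ : T.P j) : R) ∈ T.L q₀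
        rw [this]
        exact Ideal.mem_span_singleton'.2 ⟨p, rfl⟩
      · have : f p q = 0 := by simp [f, Pi.single_eq_of_ne hq]
        change T.toQ _ _ (f p q) = 0
        rw [this, map_zero]
    · intro hx
      have hx' : ∀ q : S, (x q : R) ∈ T.L q := fun q => T.toQ_eq_zero.1 (congrFun hx q)
      obtain ⟨a, ha⟩ := Ideal.mem_span_singleton'.1 (hx' q₀)
      refine ⟨a • T.gen (!j), funext fun q => ?_⟩
      by_cases hq : q = q₀
      · subst hq
        apply Subtype.ext
        rw [← ha]
        have h1 : f (a • T.gen (!j)) q₀ = f₀ (a • T.gen (!j)) := by simp [f]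
        rw [h1]
        have : a * T.e (!j) * T.m j = a * T.m j := by rw [mul_assoc, T.e_mul_m]
        exact this
      · have h1 : f (a • T.gen (!j)) q = 0 := by simp [f, Pi.single_eq_of_ne hq]
        rw [h1]
        obtain ⟨⟨i, b⟩, hq'⟩ := q
        have hi : i = j := hS _ hq'
        have hb : b = false := by
          by_contra hb
          rw [Bool.not_eq_false] at hb
          exact hq (Subtype.ext (Prod.ext hi hb))
        subst hb
        exact Subtype.ext ((Submodule.mem_bot R).1 (hx' ⟨(i, false), hq'⟩)).symm
  · intro h
    choose z hz using fun q : S => T.exists_m_smul (hS q q.2) ((h (T.gen (!j)) : ∀ q : S, T.Qq q) q)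
    let h' : (∀ q : S, T.P q.1.1) →ₗ[R] ∀ q : S, T.Qq q :=
      T.lift j (z : ∀ q : S, T.Qq q) ∘ₗ LinearMap.proj q₀
    refine ⟨h', LinearMap.ext fun p => ?_⟩
    have h1 : f p q₀ = f₀ p := by simp [f]
    have h2 : (h (T.gen (!j)) : ∀ q : S, T.Qq q) = T.m j • z := by
      funext q
      have h3 : T.e (!j) • T.gen (!j) = T.gen (!j) := Subtype.ext (T.mul_self _)
      have h4 : (h (T.gen (!j)) : ∀ q : S, T.Qq q) =
          T.e (!j) • (h (T.gen (!j)) : ∀ q : S, T.Qq q) := by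
        rw [← map_smul, h3]
      rw [h4]
      exact hz q
    have h5 : h p = (p : R) • h (T.gen (!j)) := by rw [← map_smul, T.smul_gen]
    have h5 : h p = ((p : R) • (T.m j • z) : ∀ q : S, T.Qq q) :=
      h5.trans (congrArg (fun y : ∀ q : S, T.Qq q => (p : R) • y) h2)
    rw [h5]
    have h6 : h' (f p) = ((f p q₀ : T.P j) : R) • z := rfl
    have h7 : ((f₀ p : T.P j) : R) = p * T.m j := rfl
    exact (h6.trans (by rw [h1, h7, mul_smul])).symm

theorem hom_Q_eq_zero {X : Type} [AddCommGroup X] [Module R X] {v : Bool} {L : Ideal R}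
    (h : T.Avoids v X) (f : T.Q v L →ₗ[R] X) : f = 0 := by
  ext p
  have h3 : T.e v • T.gen v = T.gen v := Subtype.ext (T.mul_self _)
  change f (T.toQ v L p) = 0
  rw [← T.smul_gen p, ← h3, map_smul, map_smul, map_smul, map_smul, h, smul_zero]

theorem isSupport_LS {S S' : Finset (Bool × Bool)} (hS : IsTauRigidCat R (T.LS S))
    (hS' : ∀ q ∈ S', q.2 = false ∧ ∀ q₁ ∈ S, q₁ = (!q.1, true)) (hc : S.card + S'.card = 2) :
    IsSupportTauTiltingCat R (T.LS S) := by
  refine ⟨hS, T.LS S', _, _, _, inferInstance, T.projective_LS fun q hq => (hS' q hq).1, ?_,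
    T.card_classes_LS S, T.card_classes_LS S', T.card_classes_regular, hc⟩
  intro f
  have : ∀ f : (∀ q : S', T.Qq q) →ₗ[R] T.LS S, f = 0 := by
    intro f
    refine LinearMap.pi_ext' fun q => ?_
    rw [LinearMap.zero_comp]
    exact T.hom_Q_eq_zero (T.avoids_LS.2 (hS' q q.2).2)
      (f ∘ₗ LinearMap.single R (fun q : S' => T.Qq q) q)
  exact this f

theorem not_splitsOver (j : Bool) : ¬ SplitsOver R (T.Qq (j, true)) (T.Q (!j) T.J) := by
  intro h
  have hk : ∀ p : T.P j, p ∈ LinearMap.ker (T.toQ j (T.L (j, true))) →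
      (p : R) ∈ T.J := fun p hp => T.L_le _ (T.toQ_eq_zero.1 hp)
  let k : LinearMap.ker (T.toQ j (T.L (j, true))) :=
    ⟨⟨T.m j, T.m_mem_P j⟩, T.toQ_eq_zero.2 (Ideal.mem_span_singleton_self _)⟩
  have hJ : T.J • LinearMap.ker (T.toQ j (T.L (j, true))) ≤
      Submodule.comap (T.P j).subtype T.I :=
    Submodule.smul_le.2 fun y hy p hp => T.mul_mem_I y hy _ (hk p hp)
  obtain ⟨φ, hφ⟩ := T.exists_hom_ne_zero (X := T.Q (!j) T.J) k (v := !j)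
    (fun h => T.m_notMem j (by
      have : T.e (!j) * T.m j ∈ T.I := hJ h
      rwa [T.e_mul_m] at this))
    (s := T.toQ _ _ (T.gen _))
    (by rw [← map_smul]; congr 1; exact Subtype.ext (T.mul_self _))
    (fun h0 => T.e_notMem _ (T.toQ_eq_zero.1 h0))
    (fun y hy => T.J_smul_Q _ hy _)
  obtain ⟨ψ, hψ⟩ := h.exists_extension _ (T.toQ_surjective _ _) LinearMap.id
    Function.surjective_id φ
  apply hφ
  rw [← hψ, ← T.smul_gen (k : T.P j), map_smul]
  exact T.J_smul_Q _ (T.m_mem_J j) _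

theorem exists_hom_ne_zero_P (v j : Bool) : ∃ f : T.Q v ⊥ →ₗ[R] T.Q j ⊥, f ≠ 0 := by
  by_cases h : v = j
  · subst h
    refine ⟨LinearMap.id, fun h => ?_⟩
    exact T.e_ne v (T.toQ_eq_zero.1 (LinearMap.congr_fun h (T.toQ v ⊥ (T.gen v))))
  · obtain rfl : v = !j := by rw [Bool.eq_not]; exact h
    refine ⟨(T.equivBot j).symm.toLinearMap ∘ₗ T.lift (!j) (⟨T.m j, T.m_mem_P j⟩ : T.P j) ∘ₗ
      (T.equivBot (!j)).toLinearMap, fun h => ?_⟩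
    have h1 := LinearMap.congr_fun h ((T.equivBot (!j)).symm (T.gen (!j)))
    simp only [LinearMap.comp_apply, LinearEquiv.coe_coe, LinearEquiv.apply_symm_apply,
      LinearMap.zero_apply, LinearEquiv.map_eq_zero_iff] at h1
    have h2 : T.e (!j) * T.m j = 0 := congrArg Subtype.val h1
    rw [T.e_mul_m] at h2
    exact T.m_notMem j (h2 ▸ T.I.zero_mem)

theorem two_le_of_regular {K : Type} [Field K] {R : Type} [Ring R] [Algebra K R]
    (T : TwoVertex K R)
    {r : ℕ} (h : HasIndecClassCount R (ModuleCat.of R R) r) : 2 ≤ r := by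
  obtain ⟨k, A, hA, hind, c, -, hc⟩ := h
  by_contra hr
  have hr' : r ≤ 1 := by omega
  have hsub : Subsingleton (Fin r) := Fin.subsingleton_iff_le_one.2 hr'
  have hex : ∀ i, ∃ v, Nonempty (A i ≃ₗ[R] T.Q v ⊥) := fun i => by
    have : Module.Finite R (A i) := Module.Finite.of_surjective (internalProj hA i) fun x =>
      ⟨x, LinearMap.congr_fun (internalProj_subtype hA i) x⟩
    have : Module.Projective R (A i) := Module.Projective.of_split (A i).subtype
      (internalProj hA i) (internalProj_subtype hA i)
    exact T.exists_equiv_of_projective (hind i)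
  choose v hv using hex
  have hvv : ∀ i j, v i = v j := fun i j => by
    obtain ⟨t⟩ := (hc i j).1 (Subsingleton.elim _ _)
    exact congrArg Prod.fst (T.eq_of_Qq_equiv (q := (v i, false)) (q' := (v j, false))
      ((hv i).some.symm ≪≫ₗ t ≪≫ₗ (hv j).some))
  obtain ⟨w, hw⟩ : ∃ w, ∀ i, v i ≠ w := by
    rcases isEmpty_or_nonempty (Fin k) with h | ⟨⟨i⟩⟩
    · exact ⟨true, fun i => h.elim i⟩
    · exact ⟨!(v i), fun j => by rw [hvv j i]; simp⟩
  have h1 : T.TopAvoids w (∀ i, A i) := BasicData.TopAvoids.pi fun i =>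
    (T.topAvoids_Q (hw i) ⊥).of_surjective (hv i).some.symm.toLinearMap
      (hv i).some.symm.surjective
  have h2 := h1.of_surjective (internalEquiv hA).symm.toLinearMap
    (internalEquiv hA).symm.surjective (1 : R)
  have h3 : T.J • (⊤ : Submodule R R) ≤ T.J :=
    Submodule.smul_le.2 fun y hy x _ => T.mul_mem_right y hy x
  have h4 := h3 h2
  rw [smul_eq_mul, mul_one] at h4
  exact T.e_notMem w h4

theorem not_support_projective {M : ModuleCat.{0} R} (hM : IsSupportTauTiltingCat R M) {j : Bool}
    (e : M ≃ₗ[R] T.Q j ⊥) : False := by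
  obtain ⟨-, P, p, q, r, _, _, hP, hp, hq, hr, hpqr⟩ := hM
  have hp1 := hp.le_one ((T.isIndec_Q_of_le bot_le).of_equiv e.symm)
  have hr2 := T.two_le_of_regular hr
  have hq1 : 0 < q := by omega
  obtain ⟨k, A, hA, hind, c, hc, -⟩ := hq
  obtain ⟨i, -⟩ := hc ⟨0, hq1⟩
  have : Module.Finite R (A i) := Module.Finite.of_surjective (internalProj hA i) fun x =>
    ⟨x, LinearMap.congr_fun (internalProj_subtype hA i) x⟩
  have : Module.Projective R (A i) := by
    refine Module.Projective.of_split (A i).subtype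
      (internalProj hA i) (internalProj_subtype hA i)
  obtain ⟨v, ⟨t⟩⟩ := T.exists_equiv_of_projective (hind i)
  obtain ⟨f, hf⟩ := T.exists_hom_ne_zero_P v j
  apply hf
  have h0 := hP (e.symm.toLinearMap ∘ₗ f ∘ₗ t.toLinearMap ∘ₗ internalProj hA i)
  refine LinearMap.ext fun x => ?_
  have h1 := LinearMap.congr_fun h0 (t.symm x : A i)
  have h2 : internalProj hA i (t.symm x : A i) = t.symm x :=
    LinearMap.congr_fun (internalProj_subtype hA i) (t.symm x)
  have h3 : e.symm (f (t (internalProj hA i (t.symm x : A i)))) = 0 := h1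
  rwa [h2, LinearEquiv.apply_symm_apply, LinearEquiv.map_eq_zero_iff] at h3

end Ring

end TwoVertex

section Shape

/-- The indecomposable summands of the support τ-tilting module at each vertex of the
Hasse quiver. -/
def summands : WithTop (WithBot (Fin 2 ⊕ Fin 2)) → Finset (Bool × Bool)
  | none => {(false, false), (true, false)}
  | some none => ∅
  | some (some (Sum.inl 0)) => {(false, true)}
  | some (some (Sum.inl 1)) => {(false, true), (false, false)}
  | some (some (Sum.inr 0)) => {(true, true)}
  | some (some (Sum.inr 1)) => {(true, true), (true, false)}

instance decidableLESum : DecidableLE (Fin 2 ⊕ Fin 2) := fun a b =>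
  inferInstanceAs (Decidable (Sum.LiftRel (· ≤ ·) (· ≤ ·) a b))

instance decidableLEShape : DecidableLE (WithTop (WithBot (Fin 2 ⊕ Fin 2))) :=
  WithTop.decidableLE

theorem exists_summand_of_le : ∀ x y, x ≤ y → ∀ q ∈ summands x,
    ∃ q' ∈ summands y, q'.1 = q.1 ∧ (q'.2 = true → q.2 = true) := by
  decide

theorem exists_eq_summands : ∀ S : Finset (Bool × Bool),
    (∀ j b, (j, true) ∈ S → (!j, b) ∉ S) → (∀ j, S ≠ {(j, false)}) →
    ∃ x, S = summands x := by
  decide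

set_option synthInstance.maxHeartbeats 400000 in
set_option synthInstance.maxSize 2000 in
theorem le_of_summands : ∀ x y,
    (∀ v, (∀ q ∈ summands y, q.1 ≠ v) → ∀ q ∈ summands x, q.1 ≠ v) →
    (∀ v, (∀ q ∈ summands y, q = (!v, true)) → ∀ q ∈ summands x, q = (!v, true)) →
    x ≤ y := by
  decide

/-- The projective part of a support τ-tilting pair. -/
def cosummands : WithTop (WithBot (Fin 2 ⊕ Fin 2)) → Finset (Bool × Bool)
  | some none => {(false, false), (true, false)}
  | some (some (Sum.inl 0)) => {(true, false)}
  | some (some (Sum.inr 0)) => {(false, false)}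
  | _ => ∅

theorem cosummands_spec : ∀ x, ∀ q ∈ cosummands x,
    q.2 = false ∧ ∀ q₁ ∈ summands x, q₁ = (!q.1, true) := by
  decide

theorem card_summands_add : ∀ x, (summands x).card + (cosummands x).card = 2 := by
  decide

theorem summands_rigid : ∀ x, (∀ q ∈ summands x, q.2 = false) ∨
    ∃ j, (j, true) ∈ summands x ∧ ∀ q ∈ summands x, q.1 = j := by
  decide

theorem card_shape : Fintype.card (WithTop (WithBot (Fin 2 ⊕ Fin 2))) = 6 := by
  decide

end Shape

namespace TwoVertex

section Classification

variable {K : Type} [Field K] {Λ : Type} [Ring Λ] [Algebra K Λᵐᵒᵖ] (T : TwoVertex K Λᵐᵒᵖ)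

theorem isBasicSupportTauTilting_summands (x : WithTop (WithBot (Fin 2 ⊕ Fin 2))) :
    IsBasicSupportTauTilting Λ (T.LS (summands x)) := by
  refine ⟨T.isSupport_LS ?_ (cosummands_spec x) (card_summands_add x), T.isBasic_LS _⟩
  rcases summands_rigid x with h | ⟨j, hj, h⟩
  · exact T.isTauRigid_LS_of_projective h
  · exact T.isTauRigid_LS hj h

theorem exists_equiv_summands {M : RMod Λ} (hM : IsBasicSupportTauTilting Λ M) :
    ∃ x, Nonempty (M ≃ₗ[Λᵐᵒᵖ] T.LS (summands x)) := by
  classical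
  obtain ⟨S, ⟨e⟩⟩ := hM.exists_finset (Q := T.Qq) fun N _ _ _ hind hN =>
    T.exists_equiv_Qq hind hN
  have hpq : ∀ j b, (j, true) ∈ S → (!j, b) ∉ S := by
    intro j b hj hb
    apply T.not_splitsOver j
    have h := hM.1.1.splitsOver
    let q₁ : S := ⟨(j, true), hj⟩
    let q₂ : S := ⟨(!j, b), hb⟩
    refine (h.of_retract (e.symm.toLinearMap ∘ₗ LinearMap.single _ (fun q : S => T.Qq q) q₁)
      (LinearMap.proj q₁ ∘ₗ e.toLinearMap) ?_).of_surjective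
      (T.factor (!j) (T.L_le (!j, b)) ∘ₗ LinearMap.proj q₂ ∘ₗ e.toLinearMap) ?_
    · refine LinearMap.ext fun y => ?_
      simp
    · exact (T.factor_surjective (!j) (T.L_le (!j, b))).comp
        ((LinearMap.proj_surjective (R := Λᵐᵒᵖ) (φ := fun q : S => T.Qq q) q₂).comp e.surjective)
  have hproj : ∀ j, S ≠ {(j, false)} := by
    rintro j rfl
    let t : (∀ q : ({(j, false)} : Finset (Bool × Bool)), T.Qq q) ≃ₗ[Λᵐᵒᵖ] T.Q j ⊥ :=
      LinearEquiv.ofBijective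
        (LinearMap.proj (⟨(j, false), Finset.mem_singleton_self _⟩ :
          ({(j, false)} : Finset (Bool × Bool))))
        ⟨fun y z h => funext fun q => by
          obtain ⟨q, hq⟩ := q
          obtain rfl := Finset.mem_singleton.1 hq
          exact h, LinearMap.proj_surjective (R := Λᵐᵒᵖ) _⟩
    exact T.not_support_projective hM.1 (e ≪≫ₗ t)
  obtain ⟨x, rfl⟩ := exists_eq_summands S hpq hproj
  exact ⟨x, ⟨e⟩⟩

theorem le_of_facLE {x y : WithTop (WithBot (Fin 2 ⊕ Fin 2))}
    (h : FacLE Λ (T.LS (summands x)) (T.LS (summands y))) : x ≤ y := by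
  obtain ⟨k, f, hf⟩ := h.exists_surjective
  refine le_of_summands x y (fun v => ?_) (fun v => ?_)
  · rw [← T.topAvoids_LS, ← T.topAvoids_LS]
    exact fun h => (BasicData.TopAvoids.pi fun _ : Fin k => h).of_surjective f hf
  · rw [← T.avoids_LS, ← T.avoids_LS]
    exact fun h => (BasicData.Avoids.pi fun _ : Fin k => h).of_surjective f hf

theorem facLE_of_le {x y : WithTop (WithBot (Fin 2 ⊕ Fin 2))} (h : x ≤ y) :
    FacLE Λ (T.LS (summands x)) (T.LS (summands y)) := by
  classical
  have hs : ∀ q : summands x, ∃ (q' : summands y) (f : T.Qq q' →ₗ[Λᵐᵒᵖ] T.Qq q),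
      Function.Surjective f := by
    rintro ⟨⟨j, b⟩, hq⟩
    obtain ⟨⟨j', b'⟩, hq', rfl, hb⟩ := exists_summand_of_le x y h _ hq
    exact ⟨⟨_, hq'⟩, T.factor j' (T.L_mono hb), T.factor_surjective _ _⟩
  choose c f hf using hs
  let g : (summands x → T.LS (summands y)) →ₗ[Λᵐᵒᵖ] (∀ q : summands x, T.Qq q) :=
    LinearMap.pi fun q => f q ∘ₗ
      (LinearMap.proj (c q) : (∀ q : summands y, T.Qq q) →ₗ[Λᵐᵒᵖ] T.Qq (c q)) ∘ₗ
      (LinearMap.proj q : (summands x → T.LS (summands y)) →ₗ[Λᵐᵒᵖ] T.LS (summands y))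
  refine FacLE.of_surjective (M := T.LS (summands x)) g fun z => ?_
  choose w hw using fun q : summands x => hf q ((z : ∀ q : summands x, T.Qq q) q)
  refine ⟨fun q => (Pi.single (c q) (w q) : ∀ q : summands y, T.Qq q), funext fun q => ?_⟩
  have : g (fun q => (Pi.single (c q) (w q) : ∀ q : summands y, T.Qq q)) q =
      f q ((Pi.single (c q) (w q) : ∀ q : summands y, T.Qq q) (c q)) := rfl
  exact this.trans (by rw [Pi.single_eq_same, hw])

theorem eq_of_summands_equiv {x y : WithTop (WithBot (Fin 2 ⊕ Fin 2))}
    (e : T.LS (summands x) ≃ₗ[Λᵐᵒᵖ] T.LS (summands y)) : x = y := by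
  refine le_antisymm (T.le_of_facLE ?_) (T.le_of_facLE ?_)
  · exact FacLE.of_surjective (ι := Unit) (e.symm.toLinearMap ∘ₗ LinearMap.proj ())
      (e.symm.surjective.comp (LinearMap.proj_surjective (R := Λᵐᵒᵖ) ()))
  · exact FacLE.of_surjective (ι := Unit) (e.toLinearMap ∘ₗ LinearMap.proj ())
      (e.surjective.comp (LinearMap.proj_surjective (R := Λᵐᵒᵖ) ()))

theorem tauTiltingData (T : TwoVertex K Λᵐᵒᵖ) : TauTiltingData Λ 6 2 2 := by
  classical
  refine ⟨isTauTiltingFinite_of_indec (Q := T.Qq) fun N _ _ _ hind hN =>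
    T.exists_equiv_Qq hind hN, ?_, fun x => T.LS (summands x),
    T.isBasicSupportTauTilting_summands, fun x y ⟨e⟩ => T.eq_of_summands_equiv e,
    fun M hM => T.exists_equiv_summands hM, fun x y => ⟨T.facLE_of_le, T.le_of_facLE⟩⟩
  let t := Fintype.equivFinOfCardEq card_shape
  refine ⟨fun i => T.LS (summands (t.symm i)), fun i => T.isBasicSupportTauTilting_summands _,
    fun i j ⟨e⟩ => t.symm.injective (T.eq_of_summands_equiv e), fun M hM => ?_⟩
  obtain ⟨x, e⟩ := T.exists_equiv_summands hM
  refine ⟨t x, ?_⟩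
  beta_reduce
  rwa [Equiv.symm_apply_apply]

end Classification

end TwoVertex

namespace BasicData

section Local

variable {K : Type} [Field K] {R : Type} [Ring R] [Algebra K R] (D : BasicData K Unit R)

theorem exists_equiv_of_local {N : Type} [AddCommGroup N] [Module R N] [Module.Finite R N]
    (hind : IsIndecModule R N) (hN : SplitsOver R N N) : Nonempty (N ≃ₗ[R] D.Q () ⊥) := by
  obtain ⟨ι, _, c, x, hsurj, hJ⟩ := D.exists_cover (N := N)
  have hker : LinearMap.ker (D.cover c x) = ⊥ := by
    by_contra hker
    obtain ⟨v, k, hk⟩ := D.exists_e_smul_notMem_of_ne_bot hker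
    rcases isEmpty_or_nonempty ι with hι | ⟨⟨i⟩⟩
    · exact hk (by rw [Subsingleton.elim (D.e v • (k : ∀ i, D.P (c i))) 0]; exact zero_mem _)
    · exact hk (D.e_smul_mem hN hsurj hJ k i)
  obtain ⟨v, hv⟩ := D.exists_equiv_of_ker_eq_bot hind hsurj hker
  exact hv

/-- The direct sum of copies of the indecomposable projective. -/
def copies (S : Finset Unit) : ModuleCat.{0} R := ModuleCat.of R (S → D.Q () ⊥)

theorem card_classes_copies (S : Finset Unit) : HasIndecClassCount R (D.copies S) S.card := by
  have := hasIndecClassCount_of_equiv (M := D.copies S) (Q := fun _ : S => D.Q () ⊥)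
    (LinearEquiv.refl R _) (fun _ => D.isIndec_Q_of_le bot_le) (fun _ _ _ => Subsingleton.elim _ _)
  rwa [Fintype.card_coe] at this

theorem isBasic_copies (S : Finset Unit) : IsBasicModuleCat R (D.copies S) :=
  isBasicModuleCat_of_equiv (M := D.copies S) (Q := fun _ : S => D.Q () ⊥)
    (LinearEquiv.refl R _) (fun _ => D.isIndec_Q_of_le bot_le)
    (fun _ _ _ => Subsingleton.elim _ _)

theorem card_classes_regular_of_local {K : Type} [Field K] {R : Type} [Ring R] [Algebra K R]
    (D : BasicData K Unit R) : HasIndecClassCount R (ModuleCat.of R R) 1 := by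
  have he : D.e () = 1 := by rw [← D.sum_e]; simp
  have hP : D.P () = ⊤ := by
    rw [eq_top_iff]
    exact fun r _ => D.mem_P.2 (by rw [he, mul_one])
  let t : R ≃ₗ[R] (Unit → D.Q () ⊥) := (LinearEquiv.ofTop _ hP).symm ≪≫ₗ
    (D.equivBot ()).symm ≪≫ₗ (LinearEquiv.funUnique Unit R (D.Q () ⊥)).symm
  exact hasIndecClassCount_of_equiv (M := ModuleCat.of R R) (Q := fun _ : Unit => D.Q () ⊥) t
    (fun _ => D.isIndec_Q_of_le bot_le) (fun _ _ _ => rfl)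

instance finite_copies (S : Finset Unit) : Module.Finite R (D.copies S) :=
  inferInstanceAs (Module.Finite R (S → D.Q () ⊥))

instance projective_copies (S : Finset Unit) : Module.Projective R (D.copies S) :=
  Module.Projective.of_equiv
    (DFinsupp.linearEquivFunOnFintype : (Π₀ _ : S, D.Q () ⊥) ≃ₗ[R] (S → D.Q () ⊥))

theorem isSupport_copies (S : Finset Unit) : IsSupportTauTiltingCat R (D.copies S) := by
  refine ⟨⟨inferInstance, ModuleCat.of R PUnit, D.copies S, 0, LinearMap.id,
    inferInstanceAs (Module.Finite R PUnit), inferInstanceAs (Module.Projective R PUnit),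
    inferInstance, inferInstance, Function.surjective_id, ?_, fun h => ⟨0, ?_⟩⟩, D.copies Sᶜ,
    _, _, _, inferInstance, inferInstance, ?_, D.card_classes_copies S,
    D.card_classes_copies Sᶜ, D.card_classes_regular_of_local, ?_⟩
  · rw [LinearMap.range_zero, LinearMap.ker_id]
  · ext x
    rw [Subsingleton.elim x 0, map_zero, map_zero]
  · intro f
    refine LinearMap.ext fun y => funext fun q => ?_
    have : y = 0 := funext fun q' => absurd q.2 (Finset.mem_compl.1 q'.2)
    rw [this, map_zero]
    rfl
  · rw [Finset.card_add_card_compl, Fintype.card_unit]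

theorem eq_of_copies_equiv {S S' : Finset Unit} (e : D.copies S ≃ₗ[R] D.copies S') : S = S' := by
  have hne : Nontrivial (D.Q () ⊥) := (D.isIndec_Q_of_le bot_le).1
  have key : ∀ S : Finset Unit, S = ∅ ↔ Subsingleton (D.copies S) := by
    intro S
    constructor
    · rintro rfl
      exact inferInstanceAs (Subsingleton ((∅ : Finset Unit) → D.Q () ⊥))
    · intro h
      by_contra hS
      obtain ⟨q, hq⟩ := Finset.nonempty_iff_ne_empty.2 hS
      obtain ⟨y, hy⟩ := exists_ne (0 : D.Q () ⊥)
      have h0 : (fun _ => y : S → D.Q () ⊥) = 0 := h.elim _ _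
      exact hy (congrFun h0 ⟨q, hq⟩)
  have h : S = ∅ ↔ S' = ∅ := by
    rw [key, key]
    exact e.toEquiv.subsingleton_congr
  revert h
  clear e
  revert S S'
  decide

end Local

section LocalClassification

variable {K : Type} [Field K] {Λ : Type} [Ring Λ] [Algebra K Λᵐᵒᵖ] (D : BasicData K Unit Λᵐᵒᵖ)

theorem isTauTiltingFinite_of_local (D : BasicData K Unit Λᵐᵒᵖ) : IsTauTiltingFinite Λ :=
  isTauTiltingFinite_of_indec (Q := fun _ : Unit => D.Q () ⊥) fun _ _ _ _ hind hN =>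
    ⟨(), D.exists_equiv_of_local hind hN⟩

theorem supportTauTiltingCount_of_local (D : BasicData K Unit Λᵐᵒᵖ) :
    SupportTauTiltingCount Λ 2 := by
  let t : Finset Unit ≃ Fin 2 := Fintype.equivFinOfCardEq (by decide)
  refine ⟨fun i => D.copies (t.symm i), fun i => ⟨D.isSupport_copies _, D.isBasic_copies _⟩,
    fun i j ⟨e⟩ => t.symm.injective (D.eq_of_copies_equiv e), fun M hM => ?_⟩
  obtain ⟨S, e⟩ := hM.exists_finset (Q := fun _ : Unit => D.Q () ⊥) fun _ _ _ _ hind hN =>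
    ⟨(), D.exists_equiv_of_local hind hN⟩
  refine ⟨t S, ?_⟩
  beta_reduce
  rw [Equiv.symm_apply_apply]
  exact e

end LocalClassification

end BasicData

section Morita

open CategoryTheory

variable {R S : Type} [Ring R] [Ring S]

/-- An equivalence of module categories identifies submodule lattices. -/
def submoduleOrderIso (F : ModuleCat.{0} R ≌ ModuleCat.{0} S) (N : ModuleCat.{0} R) :
    Submodule R N ≃o Submodule S (F.functor.obj N) :=
  (ModuleCat.subobjectModule N).symm.trans
    ((Subobject.lowerEquivalence (MonoOver.congr N F)).toOrderIso.trans
      (ModuleCat.subobjectModule (F.functor.obj N)))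

theorem isCompactElement_of_orderIso {α β : Type} [PartialOrder α] [PartialOrder β] (f : α ≃o β)
    {k : α} (hk : IsCompactElement k) : IsCompactElement (f k) := by
  intro s u hs hd hu hku
  obtain ⟨x, hx, hkx⟩ := hk (f.symm '' s) (f.symm u) (hs.image _)
    (hd.mono_comp f.symm.monotone) (by rwa [f.symm.isLUB_image, f.symm_symm, f.apply_symm_apply])
    (by rwa [f.le_symm_apply])
  obtain ⟨y, hy, rfl⟩ := hx
  exact ⟨y, hy, by rwa [f.le_symm_apply] at hkx⟩

theorem finite_functor_obj (F : ModuleCat.{0} R ≌ ModuleCat.{0} S) (N : ModuleCat.{0} R)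
    [h : Module.Finite R N] : Module.Finite S (F.functor.obj N) := by
  rw [Module.finite_def, Submodule.fg_iff_compact] at h ⊢
  rw [← (submoduleOrderIso F N).map_top]
  exact isCompactElement_of_orderIso _ h

theorem isIndec_functor_obj (F : ModuleCat.{0} R ≌ ModuleCat.{0} S) (N : ModuleCat.{0} R)
    (h : IsIndecModule R N) : IsIndecModule S (F.functor.obj N) := by
  let t := submoduleOrderIso F N
  have hN := h.1
  refine ⟨?_, fun A B hAB => ?_⟩
  · rw [← Submodule.nontrivial_iff S]
    exact t.symm.toEquiv.nontrivial
  · have := h.2 _ _ ((t.symm.isCompl_iff).1 hAB)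
    simpa using this

theorem splitsOver_functor_obj (F : ModuleCat.{0} R ≌ ModuleCat.{0} S) (N : ModuleCat.{0} R)
    (h : SplitsOver R N N) : SplitsOver S (F.functor.obj N) (F.functor.obj N) := by
  intro X E _ _ _ _ i g π hi hg hig hπ
  let T : ShortComplex (ModuleCat.{0} S) :=
    ModuleCat.shortComplexOfCompEqZero i g (LinearMap.range_le_ker_iff.1 hig.le)
  have hT : T.ShortExact := ModuleCat.shortComplex_shortExact T
    (LinearMap.exact_iff.2 hig.symm) hi hg
  have hGT := hT.map_of_exact F.inverse
  let u : F.inverse.obj (F.functor.obj N) ≅ N := (F.unitIso.app N).symm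
  have h' : SplitsOver R (F.inverse.obj (F.functor.obj N)) (F.inverse.obj (F.functor.obj N)) :=
    (h.of_retract u.hom.hom u.inv.hom (by
      rw [← ModuleCat.hom_comp, u.hom_inv_id, ModuleCat.hom_id])).of_surjective u.inv.hom
      u.toLinearEquiv.symm.surjective
  have hπ' : Function.Surjective (F.inverse.map (ModuleCat.ofHom π)) := by
    have : Epi (ModuleCat.ofHom π) := (ModuleCat.epi_iff_surjective _).2 hπ
    exact (ModuleCat.epi_iff_surjective _).1 inferInstance
  obtain ⟨s, hs⟩ := h' _ _ _ _ (F.inverse.map (ModuleCat.ofHom π)).hom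
    hGT.moduleCat_injective_f hGT.moduleCat_surjective_g hGT.exact.moduleCat_range_eq_ker hπ'
  have hs' : ModuleCat.ofHom s ≫ F.inverse.map (ModuleCat.ofHom g) = 𝟙 _ :=
    ModuleCat.hom_ext hs
  obtain ⟨s', hs''⟩ := F.inverse.map_surjective (X := F.functor.obj N) (Y := ModuleCat.of S E)
    (ModuleCat.ofHom s)
  refine ⟨s'.hom, ?_⟩
  have : s' ≫ ModuleCat.ofHom g = 𝟙 _ := by
    apply F.inverse.map_injective
    rw [F.inverse.map_comp, hs'', F.inverse.map_id]
    exact hs'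
  exact congrArg ModuleCat.Hom.hom this

end Morita

section MoritaFiniteness

open CategoryTheory

/-- A bound on the indecomposable rigid modules of an algebra gives τ-tilting finiteness of
all Morita equivalent algebras. -/
theorem MoritaEquivalent.isTauTiltingFinite {Λ D : Type} [Ring Λ] [Ring D]
    (h : MoritaEquivalent Λ D) {κ : Type} [Fintype κ] [DecidableEq κ] {Q : κ → Type}
    [∀ i, AddCommGroup (Q i)] [∀ i, Module Dᵐᵒᵖ (Q i)]
    (hQ : ∀ (N : Type) [AddCommGroup N] [Module Dᵐᵒᵖ N], Module.Finite Dᵐᵒᵖ N →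
      IsIndecModule Dᵐᵒᵖ N → SplitsOver Dᵐᵒᵖ N N → ∃ a, Nonempty (N ≃ₗ[Dᵐᵒᵖ] Q a)) :
    IsTauTiltingFinite Λ := by
  obtain ⟨F⟩ := h
  refine isTauTiltingFinite_of_indec
    (Q := fun a : κ => F.inverse.obj (ModuleCat.of Dᵐᵒᵖ (Q a))) fun N _ _ hfin hind hN => ?_
  let N' := ModuleCat.of Λᵐᵒᵖ N
  have : Module.Finite Λᵐᵒᵖ N' := hfin
  obtain ⟨a, ⟨e⟩⟩ := hQ _ (finite_functor_obj F N') (isIndec_functor_obj F N' hind)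
    (splitsOver_functor_obj F N' hN)
  exact ⟨a, ⟨(F.unitIso.app N' ≪≫ F.inverse.mapIso
    (e.toModuleIso : F.functor.obj N' ≅ ModuleCat.of Dᵐᵒᵖ (Q a))).toLinearEquiv⟩⟩

end MoritaFiniteness

section Generation

variable {K : Type} [Field K] {R : Type} [Ring R] [Algebra K R]

/-- A set generates the algebra `R`. -/
def Generates (K : Type) [Field K] {R : Type} [Ring R] [Algebra K R] (s : Set R) : Prop :=
  ∀ C : Subalgebra K R, s ⊆ C → C = ⊤

theorem Generates.mul_mem_left {s : Set R} (hs : Generates K s) {W : Set R}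
    (h : ∀ g ∈ s, ∀ w ∈ W, g * w ∈ Submodule.span K W) (r : R) {x : R}
    (hx : x ∈ Submodule.span K W) : r * x ∈ Submodule.span K W := by
  have hr : r ∈ Algebra.adjoin K s := by
    rw [hs _ Algebra.subset_adjoin]
    trivial
  induction hr using Algebra.adjoin_induction generalizing x with
  | mem g hg =>
    induction hx using Submodule.span_induction with
    | mem w hw => exact h g hg w hw
    | zero => rw [mul_zero]; exact zero_mem _
    | add y z _ _ hy hz => rw [mul_add]; exact add_mem hy hz
    | smul c y _ hy => rw [mul_smul_comm]; exact Submodule.smul_mem _ _ hy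
  | algebraMap c => rw [← Algebra.smul_def]; exact Submodule.smul_mem _ _ hx
  | add y z _ _ hy hz => rw [add_mul]; exact add_mem (hy hx) (hz hx)
  | mul y z _ _ hy hz => rw [mul_assoc]; exact hy (hz hx)

theorem Generates.op {s : Set R} (hs : Generates K s) :
    Generates K (MulOpposite.unop ⁻¹' s : Set Rᵐᵒᵖ) := by
  intro C hC
  have := hs C.unop fun x hx => hC (a := MulOpposite.op x) hx
  rw [eq_top_iff]
  intro x _
  have hx : x.unop ∈ C.unop := by rw [this]; trivial
  exact hx

theorem Generates.mul_mem_right {s : Set R} (hs : Generates K s) {W : Set R}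
    (h : ∀ g ∈ s, ∀ w ∈ W, w * g ∈ Submodule.span K W) (r : R) {x : R}
    (hx : x ∈ Submodule.span K W) : x * r ∈ Submodule.span K W := by
  have hr : r ∈ Algebra.adjoin K s := by
    rw [hs _ Algebra.subset_adjoin]
    trivial
  induction hr using Algebra.adjoin_induction generalizing x with
  | mem g hg =>
    induction hx using Submodule.span_induction with
    | mem w hw => exact h g hg w hw
    | zero => rw [zero_mul]; exact zero_mem _
    | add y z _ _ hy hz => rw [add_mul]; exact add_mem hy hz
    | smul c y _ hy => rw [smul_mul_assoc]; exact Submodule.smul_mem _ _ hy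
  | algebraMap c => rw [← Algebra.commutes, ← Algebra.smul_def]; exact Submodule.smul_mem _ _ hx
  | add y z _ _ hy hz => rw [mul_add]; exact add_mem (hy hx) (hz hx)
  | mul y z _ _ hy hz => rw [← mul_assoc]; exact hz (hy hx)

/-- A span stable under left multiplication, as a left ideal. -/
def spanIdeal (K : Type) [Field K] {R : Type} [Ring R] [Algebra K R] (W : Set R)
    (h : ∀ r : R, ∀ x ∈ Submodule.span K W, r * x ∈ Submodule.span K W) : Ideal R where
  carrier := Submodule.span K W
  add_mem' := add_mem
  zero_mem' := zero_mem _
  smul_mem' := h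

end Generation

/-- Generators and relations of an algebra with two vertices, a loop at each of them and arrows
in both directions, where the product of a loop and an arrow vanishes. -/
structure TwoLoopData (K : Type) [Field K] (R : Type) [Ring R] [Algebra K R] where
  e : Bool → R
  a : Bool → R
  m : Bool → R
  e_mul_e : ∀ j, e j * e j = e j
  e_mul_not : ∀ j, e j * e (!j) = 0
  e_add : e true + e false = 1
  e_mul_a : ∀ j, e j * a j = a j
  a_mul_e : ∀ j, a j * e j = a j
  e_mul_m : ∀ j, e (!j) * m j = m j
  m_mul_e : ∀ j, m j * e j = m j
  a_mul_m : ∀ j, a (!j) * m j = 0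
  m_mul_a : ∀ j, m j * a j = 0
  a_cube : ∀ j, a j ^ 3 = 0
  m_cube : ∀ j, (m (!j) * m j) ^ 3 = 0
  generates : Generates K (Set.range e ∪ Set.range a ∪ Set.range m)
  exists_hom : ∀ j, ∃ (A : Type) (_ : Ring A) (_ : Algebra K A) (φ : R →ₐ[K] A),
    φ (m j) ≠ 0 ∧ φ (m (!j)) = 0 ∧ ∀ i, φ (a i) = 0

namespace TwoLoopData

variable {K : Type} [Field K] {R : Type} [Ring R] [Algebra K R] (D : TwoLoopData K R)

/-- The opposite data. -/
def op : TwoLoopData K Rᵐᵒᵖ where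
  e j := .op (D.e j)
  a j := .op (D.a j)
  m j := .op (D.m (!j))
  e_mul_e j := congrArg MulOpposite.op (D.e_mul_e j)
  e_mul_not j := congrArg MulOpposite.op (by simpa using D.e_mul_not (!j))
  e_add := congrArg MulOpposite.op D.e_add
  e_mul_a j := congrArg MulOpposite.op (D.a_mul_e j)
  a_mul_e j := congrArg MulOpposite.op (D.e_mul_a j)
  e_mul_m j := congrArg MulOpposite.op (D.m_mul_e (!j))
  m_mul_e j := congrArg MulOpposite.op (by simpa using D.e_mul_m (!j))
  a_mul_m j := congrArg MulOpposite.op (D.m_mul_a (!j))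
  m_mul_a j := congrArg MulOpposite.op (by simpa using D.a_mul_m (!j))
  a_cube j := congrArg MulOpposite.op (D.a_cube j)
  m_cube j := congrArg MulOpposite.op (by simpa using D.m_cube j)
  generates C hC := by
    refine D.generates.op C fun x hx => hC ?_
    rcases hx with (⟨j, hj⟩ | ⟨j, hj⟩) | ⟨j, hj⟩
    · exact Or.inl (Or.inl ⟨j, congrArg MulOpposite.op hj⟩)
    · exact Or.inl (Or.inr ⟨j, congrArg MulOpposite.op hj⟩)
    · exact Or.inr ⟨!j, by
        change MulOpposite.op (D.m (!!j)) = x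
        rw [Bool.not_not]
        exact congrArg MulOpposite.op hj⟩
  exists_hom j := by
    obtain ⟨A, _, _, φ, h1, h2, h3⟩ := D.exists_hom (!j)
    exact ⟨Aᵐᵒᵖ, inferInstance, inferInstance, AlgHom.op φ,
      fun h => h1 (MulOpposite.op_injective h), congrArg MulOpposite.op h2,
      fun i => congrArg MulOpposite.op (h3 i)⟩

/-- The alternating path of length `k` starting at `j`. -/
def path : ℕ → Bool → R
  | 0, j => D.e j
  | k + 1, j => path k (!j) * D.m j

theorem path_zero (j : Bool) : D.path 0 j = D.e j := rfl

theorem path_succ (k : ℕ) (j : Bool) : D.path (k + 1) j = D.path k (!j) * D.m j := rfl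

theorem path_one (j : Bool) : D.path 1 j = D.m j := D.e_mul_m j

/-- Paths, and powers of loops, of length at least `n`. -/
def words (n : ℕ) : Set R :=
  {x | ∃ k j, n ≤ k ∧ D.path k j = x} ∪ {x | ∃ k j, n ≤ k ∧ 1 ≤ k ∧ D.a j ^ k = x}

/-- The span of the words of length at least `n`. -/
abbrev F (n : ℕ) : Submodule K R := Submodule.span K (D.words n)

theorem path_mem {n k : ℕ} (h : n ≤ k) (j : Bool) : D.path k j ∈ D.F n :=
  Submodule.subset_span (Or.inl ⟨k, j, h, rfl⟩)

theorem pow_mem {n k : ℕ} (h : n ≤ k) (h' : 1 ≤ k) (j : Bool) : D.a j ^ k ∈ D.F n :=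
  Submodule.subset_span (Or.inr ⟨k, j, h, h', rfl⟩)

theorem F_anti {n n' : ℕ} (h : n ≤ n') : D.F n' ≤ D.F n := by
  refine Submodule.span_mono ?_
  rintro x (⟨k, j, hk, rfl⟩ | ⟨k, j, hk, hk', rfl⟩)
  · exact Or.inl ⟨k, j, h.trans hk, rfl⟩
  · exact Or.inr ⟨k, j, h.trans hk, hk', rfl⟩

theorem e_mul_a' (i j : Bool) : D.e i * D.a j = D.a j ∨ D.e i * D.a j = 0 := by
  rcases Bool.eq_or_eq_not j i with rfl | rfl
  · exact Or.inl (D.e_mul_a _)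
  · exact Or.inr (by rw [← D.e_mul_a, ← mul_assoc, D.e_mul_not, zero_mul])

theorem a_mul_e' (i j : Bool) : D.a j * D.e i = D.a j ∨ D.a j * D.e i = 0 := by
  rcases Bool.eq_or_eq_not i j with rfl | rfl
  · exact Or.inl (D.a_mul_e _)
  · exact Or.inr (by rw [← D.a_mul_e, mul_assoc, D.e_mul_not, mul_zero])

theorem m_mul_e' (i j : Bool) : D.m j * D.e i = D.m j ∨ D.m j * D.e i = 0 := by
  rcases Bool.eq_or_eq_not i j with rfl | rfl
  · exact Or.inl (D.m_mul_e _)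
  · exact Or.inr (by rw [← D.m_mul_e, mul_assoc, D.e_mul_not, mul_zero])

theorem e_mul_e' (i j : Bool) : D.e i * D.e j = D.e j ∨ D.e i * D.e j = 0 := by
  rcases Bool.eq_or_eq_not j i with rfl | rfl
  · exact Or.inl (D.e_mul_e _)
  · exact Or.inr (D.e_mul_not _)

theorem a_mul_a' {i j : Bool} (h : i ≠ j) : D.a i * D.a j = 0 := by
  obtain rfl : j = !i := by rw [Bool.eq_not]; exact h.symm
  rw [← D.a_mul_e, ← D.e_mul_a (!i), mul_assoc, ← mul_assoc (D.e i), D.e_mul_not, zero_mul,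
    mul_zero]

theorem a_mul_m' (i j : Bool) : D.a i * D.m j = 0 := by
  rcases Bool.eq_or_eq_not i j with rfl | rfl
  · rw [← D.a_mul_e, ← D.e_mul_m, mul_assoc, ← mul_assoc (D.e i), D.e_mul_not, zero_mul, mul_zero]
  · exact D.a_mul_m j

theorem m_mul_a' (i j : Bool) : D.m i * D.a j = 0 := by
  rcases Bool.eq_or_eq_not j i with rfl | rfl
  · exact D.m_mul_a _
  · rw [← D.m_mul_e, ← D.e_mul_a, mul_assoc, ← mul_assoc (D.e i), D.e_mul_not, zero_mul, mul_zero]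

theorem e_mul_path (i : Bool) (k : ℕ) (j : Bool) :
    D.e i * D.path k j = D.path k j ∨ D.e i * D.path k j = 0 := by
  induction k generalizing j with
  | zero => exact D.e_mul_e' i j
  | succ k ih =>
    rw [path_succ, ← mul_assoc]
    rcases ih (!j) with h | h
    · exact Or.inl (by rw [h])
    · exact Or.inr (by rw [h, zero_mul])

theorem path_mul_e (i : Bool) (k : ℕ) (j : Bool) :
    D.path k j * D.e i = D.path k j ∨ D.path k j * D.e i = 0 := by
  rcases k with _ | k
  · rcases Bool.eq_or_eq_not i j with rfl | rfl
    · exact Or.inl (D.e_mul_e _)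
    · exact Or.inr (D.e_mul_not _)
  · rw [path_succ, mul_assoc]
    rcases D.m_mul_e' i j with h | h
    · exact Or.inl (by rw [h])
    · exact Or.inr (by rw [h, mul_zero])

theorem m_mul_path (i : Bool) (k : ℕ) (j : Bool) :
    D.m i * D.path k j = D.path (k + 1) j ∨ D.m i * D.path k j = 0 := by
  induction k generalizing j with
  | zero =>
    rw [path_zero, path_one]
    rcases Bool.eq_or_eq_not j i with rfl | rfl
    · exact Or.inl (D.m_mul_e _)
    · exact Or.inr (by rw [← D.m_mul_e, mul_assoc, D.e_mul_not, mul_zero])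
  | succ k ih =>
    rw [path_succ, ← mul_assoc, D.path_succ (k + 1)]
    rcases ih (!j) with h | h
    · exact Or.inl (by rw [h])
    · exact Or.inr (by rw [h, zero_mul])

theorem path_mul_m (i : Bool) (k : ℕ) (j : Bool) :
    D.path k j * D.m i = D.path (k + 1) i ∨ D.path k j * D.m i = 0 := by
  rcases Bool.eq_or_eq_not j (!i) with rfl | h
  · exact Or.inl rfl
  · rw [Bool.not_not] at h
    subst h
    right
    rcases k with _ | k
    · rw [path_zero, ← D.e_mul_m, ← mul_assoc, D.e_mul_not, zero_mul]
    · have h : D.m j * D.e j * (D.e (!j) * D.m j) = 0 := by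
        rw [mul_assoc, ← mul_assoc (D.e j), D.e_mul_not, zero_mul, mul_zero]
      rw [D.m_mul_e, D.e_mul_m] at h
      rw [path_succ, mul_assoc, h, mul_zero]

theorem exists_m_mul_path (k : ℕ) (j : Bool) : ∃ i, D.path (k + 1) j = D.m i * D.path k j := by
  induction k generalizing j with
  | zero => exact ⟨j, by rw [path_zero, path_one, D.m_mul_e]⟩
  | succ k ih =>
    obtain ⟨i, hi⟩ := ih (!j)
    exact ⟨i, by rw [path_succ, hi, mul_assoc, ← path_succ]⟩

theorem a_mul_path (i : Bool) (k : ℕ) (j : Bool) : D.a i * D.path (k + 1) j = 0 := by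
  obtain ⟨l, hl⟩ := D.exists_m_mul_path k j
  rw [hl, ← mul_assoc, D.a_mul_m', zero_mul]

theorem a_mul_mem {n : ℕ} (i : Bool) {w : R} (hw : w ∈ D.words n) : D.a i * w ∈ D.F (n + 1) := by
  rcases hw with ⟨k, j, hk, rfl⟩ | ⟨k, j, hk, hk', rfl⟩
  · rcases k with _ | k
    · rcases D.a_mul_e' j i with h | h
      · rw [path_zero, h, ← pow_one (D.a i)]
        exact D.pow_mem (by omega) le_rfl i
      · rw [path_zero, h]
        exact zero_mem _
    · rw [a_mul_path]
      exact zero_mem _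
  · by_cases h : i = j
    · subst h
      rw [← pow_succ']
      exact D.pow_mem (by omega) (by omega) i
    · obtain ⟨k, rfl⟩ := Nat.exists_eq_add_of_le' hk'
      rw [pow_succ', ← mul_assoc, D.a_mul_a' h, zero_mul]
      exact zero_mem _

theorem m_mul_mem {n : ℕ} (i : Bool) {w : R} (hw : w ∈ D.words n) : D.m i * w ∈ D.F (n + 1) := by
  rcases hw with ⟨k, j, hk, rfl⟩ | ⟨k, j, hk, hk', rfl⟩
  · rcases D.m_mul_path i k j with h | h
    · rw [h]
      exact D.path_mem (by omega) j
    · rw [h]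
      exact zero_mem _
  · obtain ⟨k, rfl⟩ := Nat.exists_eq_add_of_le' hk'
    rw [pow_succ', ← mul_assoc, D.m_mul_a', zero_mul]
    exact zero_mem _

theorem e_mul_mem {n : ℕ} (i : Bool) {w : R} (hw : w ∈ D.words n) : D.e i * w ∈ D.F n := by
  rcases hw with ⟨k, j, hk, rfl⟩ | ⟨k, j, hk, hk', rfl⟩
  · rcases D.e_mul_path i k j with h | h
    · rw [h]
      exact D.path_mem hk j
    · rw [h]
      exact zero_mem _
  · obtain ⟨k, rfl⟩ := Nat.exists_eq_add_of_le' hk'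
    rw [pow_succ', ← mul_assoc]
    rcases D.e_mul_a' i j with h | h
    · rw [h, ← pow_succ']
      exact D.pow_mem hk hk' j
    · rw [h, zero_mul]
      exact zero_mem _

theorem mul_mem_F {n : ℕ} (r : R) {x : R} (hx : x ∈ D.F n) : r * x ∈ D.F n := by
  refine D.generates.mul_mem_left ?_ r hx
  rintro g ((⟨j, rfl⟩ | ⟨j, rfl⟩) | ⟨j, rfl⟩) w hw
  · exact D.e_mul_mem j hw
  · exact D.F_anti n.le_succ (D.a_mul_mem j hw)
  · exact D.F_anti n.le_succ (D.m_mul_mem j hw)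

theorem F_mul_mem {n : ℕ} (r : R) {x : R} (hx : x ∈ D.F n) : x * r ∈ D.F n := by
  refine D.generates.mul_mem_right ?_ r hx
  rintro g ((⟨i, rfl⟩ | ⟨i, rfl⟩) | ⟨i, rfl⟩) w hw
  · rcases hw with ⟨k, j, hk, rfl⟩ | ⟨k, j, hk, hk', rfl⟩
    · rcases D.path_mul_e i k j with h | h
      · rw [h]
        exact D.path_mem hk j
      · rw [h]
        exact zero_mem _
    · obtain ⟨k, rfl⟩ := Nat.exists_eq_add_of_le' hk'
      rw [pow_succ, mul_assoc]
      rcases D.a_mul_e' i j with h | h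
      · rw [h, ← pow_succ]
        exact D.pow_mem hk hk' j
      · rw [h, mul_zero]
        exact zero_mem _
  · rcases hw with ⟨k, j, hk, rfl⟩ | ⟨k, j, hk, hk', rfl⟩
    · rcases k with _ | k
      · rcases D.e_mul_a' j i with h | h
        · rw [path_zero, h, ← pow_one (D.a i)]
          exact D.pow_mem (by omega) le_rfl i
        · rw [path_zero, h]
          exact zero_mem _
      · rw [path_succ, mul_assoc, D.m_mul_a', mul_zero]
        exact zero_mem _
    · by_cases h : j = i
      · subst h
        rw [← pow_succ]
        exact D.pow_mem (by omega) (by omega) j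
      · obtain ⟨k, rfl⟩ := Nat.exists_eq_add_of_le' hk'
        rw [pow_succ, mul_assoc, D.a_mul_a' h, mul_zero]
        exact zero_mem _
  · rcases hw with ⟨k, j, hk, rfl⟩ | ⟨k, j, hk, hk', rfl⟩
    · rcases D.path_mul_m i k j with h | h
      · rw [h]
        exact D.path_mem (by omega) i
      · rw [h]
        exact zero_mem _
    · obtain ⟨k, rfl⟩ := Nat.exists_eq_add_of_le' hk'
      rw [pow_succ, mul_assoc, D.a_mul_m', mul_zero]
      exact zero_mem _

/-- The two-sided ideal spanned by words of length at least `n`. -/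
def ideal (n : ℕ) : Ideal R := spanIdeal K (D.words n) fun r _ hx => D.mul_mem_F r hx

theorem mem_ideal {n : ℕ} {x : R} : x ∈ D.ideal n ↔ x ∈ D.F n := Iff.rfl

theorem ideal_zero : D.ideal 0 = ⊤ := by
  rw [Ideal.eq_top_iff_one, mem_ideal, ← D.e_add]
  exact add_mem (D.path_mem le_rfl true) (D.path_mem le_rfl false)

theorem mul_mem_succ {n : ℕ} {x y : R} (hx : x ∈ D.F 1) (hy : y ∈ D.F n) :
    x * y ∈ D.F (n + 1) := by
  induction hx using Submodule.span_induction with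
  | zero => rw [zero_mul]; exact zero_mem _
  | add x x' _ _ hx hx' => rw [add_mul]; exact add_mem hx hx'
  | smul c x _ hx => rw [smul_mul_assoc]; exact Submodule.smul_mem _ _ hx
  | mem w hw =>
    induction hy using Submodule.span_induction with
    | zero => rw [mul_zero]; exact zero_mem _
    | add y y' _ _ hy hy' => rw [mul_add]; exact add_mem hy hy'
    | smul c y _ hy => rw [mul_smul_comm]; exact Submodule.smul_mem _ _ hy
    | mem y hy =>
      rcases hw with ⟨k, j, hk, rfl⟩ | ⟨k, j, hk, -, rfl⟩
      · obtain ⟨k, rfl⟩ := Nat.exists_eq_add_of_le' hk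
        rw [path_succ, mul_assoc]
        exact D.mul_mem_F _ (D.m_mul_mem j hy)
      · obtain ⟨k, rfl⟩ := Nat.exists_eq_add_of_le' hk
        rw [pow_succ, mul_assoc]
        exact D.mul_mem_F _ (D.a_mul_mem j hy)

theorem path_eq_zero (k : ℕ) (j : Bool) : D.path (k + 6) j = 0 := by
  induction k generalizing j with
  | zero =>
    have := D.m_cube j
    simp only [pow_succ, pow_zero, one_mul] at this
    simp only [path, Bool.not_not]
    rw [mul_assoc, mul_assoc, mul_assoc, mul_assoc, mul_assoc]
    simp only [mul_assoc] at this
    rw [this, mul_zero]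
  | succ k ih => rw [Nat.succ_add, path_succ, ih, zero_mul]

theorem ideal_six : D.ideal 6 = ⊥ := by
  rw [eq_bot_iff]
  intro x hx
  rw [mem_ideal] at hx
  have : D.F 6 ≤ ⊥ := by
    refine Submodule.span_le.2 ?_
    rintro x (⟨k, j, hk, rfl⟩ | ⟨k, j, hk, -, rfl⟩)
    · obtain ⟨k, rfl⟩ := Nat.exists_eq_add_of_le' hk
      exact D.path_eq_zero k j
    · exact pow_eq_zero_of_le (by omega) (D.a_cube j)
  exact this hx

theorem m_notMem (j : Bool) : D.m j ∉ D.ideal 2 := by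
  intro h
  rw [mem_ideal] at h
  obtain ⟨A, _, _, φ, h1, h2, h3⟩ := D.exists_hom j
  have : D.F 2 ≤ LinearMap.ker φ.toLinearMap := by
    refine Submodule.span_le.2 ?_
    rintro x (⟨k, i, hk, rfl⟩ | ⟨k, i, -, hk, rfl⟩)
    · obtain ⟨k, rfl⟩ := Nat.exists_eq_add_of_le' hk
      change φ (D.path (k + 2) i) = 0
      rw [path_succ, path_succ, map_mul, map_mul]
      rcases Bool.eq_or_eq_not i j with rfl | rfl
      · rw [h2, mul_zero, zero_mul]
      · rw [h2, mul_zero]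
    · change φ (D.a i ^ k) = 0
      rw [map_pow, h3, zero_pow (by omega)]
  exact h1 (this h)

theorem exists_residue (r : R) : ∃ c : Bool → K, r - ∑ v, c v • D.e v ∈ D.F 1 := by
  have hr : r ∈ D.F 0 := by
    rw [← mem_ideal, ideal_zero]
    trivial
  induction hr using Submodule.span_induction with
  | zero => exact ⟨0, by simp⟩
  | add x y _ _ hx hy =>
    obtain ⟨c, hc⟩ := hx
    obtain ⟨d, hd⟩ := hy
    refine ⟨c + d, ?_⟩
    have := add_mem hc hd
    convert this using 1
    simp only [Pi.add_apply, add_smul, Finset.sum_add_distrib]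
    abel
  | smul t x _ hx =>
    obtain ⟨c, hc⟩ := hx
    refine ⟨t • c, ?_⟩
    have := Submodule.smul_mem _ t hc
    rw [smul_sub, Finset.smul_sum] at this
    simpa [mul_smul] using this
  | mem x hx =>
    rcases hx with ⟨k, j, -, rfl⟩ | ⟨k, j, -, hk, rfl⟩
    · rcases k with _ | k
      · refine ⟨Pi.single j 1, ?_⟩
        rw [Finset.sum_eq_single j]
        · rw [Pi.single_eq_same, one_smul, path_zero, sub_self]
          exact zero_mem _
        · intro i _ hi
          rw [Pi.single_eq_of_ne hi, zero_smul]
        · simp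
      · exact ⟨0, by simpa using D.path_mem (by omega) j⟩
    · exact ⟨0, by simpa using D.pow_mem hk hk j⟩

theorem e_mul_e_of_ne {v w : Bool} (h : v ≠ w) : D.e v * D.e w = 0 := by
  obtain rfl : w = !v := by rw [Bool.eq_not]; exact h.symm
  exact D.e_mul_not v

/-- The associated basic data. -/
def toBasicData : BasicData K Bool R where
  e := D.e
  J := D.ideal 1
  mul_mem_right x hx r := D.F_mul_mem r hx
  filt := D.ideal
  filt_zero := D.ideal_zero
  mul_filt n := by
    rw [Ideal.mul_le]
    exact fun x hx y hy => D.mul_mem_succ hx hy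
  filt_bot := ⟨6, D.ideal_six⟩
  mul_self := D.e_mul_e
  mul_ne v w h := D.e_mul_e_of_ne h
  sum_e := by rw [Fintype.sum_bool, D.e_add]
  e_ne v h := D.m_notMem v (by
    rw [← D.m_mul_e, h, mul_zero]
    exact zero_mem _)
  residue v r := by
    obtain ⟨c, hc⟩ := D.exists_residue r
    refine ⟨c v, ?_, ?_⟩
    · have := D.mul_mem_F (D.e v) hc
      rwa [mul_sub, Finset.mul_sum, Finset.sum_eq_single v, mul_smul_comm, D.e_mul_e] at this
      · intro w _ hw
        rw [mul_smul_comm, D.e_mul_e_of_ne hw.symm, smul_zero]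
      · simp
    · have := D.F_mul_mem (D.e v) hc
      rwa [sub_mul, Finset.sum_mul, Finset.sum_eq_single v, smul_mul_assoc, D.e_mul_e] at this
      · intro w _ hw
        rw [smul_mul_assoc, D.e_mul_e_of_ne hw, smul_zero]
      · simp

theorem e_mul_pow_mul_e (j i : Bool) {k : ℕ} (hk : 1 ≤ k) :
    D.e (!j) * D.a i ^ k * D.e j = 0 := by
  obtain ⟨k, rfl⟩ := Nat.exists_eq_add_of_le' hk
  rcases Bool.eq_or_eq_not i j with rfl | rfl
  · have h : D.e (!i) * D.e i = 0 := by simpa using D.e_mul_not (!i)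
    rw [pow_succ', ← D.e_mul_a, ← mul_assoc, ← mul_assoc, h]
    simp only [zero_mul]
  · have h : D.e (!j) * D.e j = 0 := by simpa using D.e_mul_not (!j)
    rw [pow_succ, ← D.a_mul_e, mul_assoc, mul_assoc, mul_assoc, h]
    simp only [mul_zero]

theorem exists_mul_m (j : Bool) (r : R) : ∃ x, D.e (!j) * r * D.e j = x * D.m j := by
  have hr : r ∈ D.F 0 := by
    rw [← mem_ideal, ideal_zero]
    trivial
  induction hr using Submodule.span_induction with
  | zero => exact ⟨0, by simp⟩
  | add x y _ _ hx hy =>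
    obtain ⟨c, hc⟩ := hx
    obtain ⟨d, hd⟩ := hy
    exact ⟨c + d, by rw [mul_add, add_mul, add_mul, hc, hd]⟩
  | smul t x _ hx =>
    obtain ⟨c, hc⟩ := hx
    exact ⟨t • c, by rw [mul_smul_comm, smul_mul_assoc, smul_mul_assoc, hc]⟩
  | mem x hx =>
    rcases hx with ⟨k, i, -, rfl⟩ | ⟨k, i, -, hk, rfl⟩
    · rcases k with _ | k
      · refine ⟨0, ?_⟩
        rw [path_zero, zero_mul]
        rcases Bool.eq_or_eq_not i j with rfl | rfl
        · rw [mul_assoc, D.e_mul_e, D.e_mul_e_of_ne (by simp)]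
        · rw [D.e_mul_e, D.e_mul_e_of_ne (by simp)]
      · rcases Bool.eq_or_eq_not j i with rfl | rfl
        · exact ⟨D.e (!j) * D.path k (!j), by
            rw [path_succ, mul_assoc, mul_assoc, D.m_mul_e, mul_assoc]⟩
        · refine ⟨0, ?_⟩
          rw [path_succ, ← D.m_mul_e, mul_assoc, mul_assoc, mul_assoc, D.e_mul_not]
          simp only [mul_zero, zero_mul]
    · exact ⟨0, by rw [D.e_mul_pow_mul_e j i hk, zero_mul]⟩

theorem exists_m_mul (j : Bool) (r : R) : ∃ x, D.e (!j) * r * D.e j = D.m j * x := by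
  obtain ⟨x, hx⟩ := D.op.exists_mul_m (!j) (.op r)
  refine ⟨x.unop, ?_⟩
  have := congrArg MulOpposite.unop hx
  simpa [op, mul_assoc] using this

/-- The associated two-vertex data. -/
def toTwoVertex : TwoVertex K R where
  toBasicData := D.toBasicData
  m := D.m
  e_mul_m := D.e_mul_m
  m_mul_e := D.m_mul_e
  m_left := D.exists_mul_m
  m_right := D.exists_m_mul
  I := D.ideal 2
  mul_mem_I _ hx _ hy := D.mul_mem_succ hx hy
  I_mul _ hy r := D.F_mul_mem r hy
  m_notMem := D.m_notMem

end TwoLoopData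

namespace BoundQuiver

variable {K : Type} [Field K] {σ : Type} {s t : σ → Fin 2}
  {rels : Set (FreeAlgebra K (TPGen σ) × FreeAlgebra K (TPGen σ))}

/-- The projection from the free algebra. -/
def proj (K : Type) [Field K] {σ : Type} (s t : σ → Fin 2)
    (rels : Set (FreeAlgebra K (TPGen σ) × FreeAlgebra K (TPGen σ))) :
    FreeAlgebra K (TPGen σ) →ₐ[K] BoundQuiverAlgebra K σ s t rels :=
  RingQuot.mkAlgHom K (QuivRel K σ s t rels)

theorem proj_eq {p q : FreeAlgebra K (TPGen σ)} (h : QuivRel K σ s t rels p q) :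
    proj K s t rels p = proj K s t rels q :=
  RingQuot.mkAlgHom_rel K h

theorem proj_rel {p q : FreeAlgebra K (TPGen σ)} (h : (p, q) ∈ rels) :
    proj K s t rels p = proj K s t rels q :=
  proj_eq (.rel (p, q) h)

theorem generates : Generates K
    (Set.range (fun i => proj K s t rels (vtx K i)) ∪
      Set.range fun x => proj K s t rels (arr K x)) := by
  intro C hC
  have h : C.comap (proj K s t rels) = ⊤ := by
    rw [eq_top_iff, ← FreeAlgebra.adjoin_range_ι, Algebra.adjoin_le_iff]
    rintro _ ⟨i | x, rfl⟩
    · exact hC (Or.inl ⟨i, rfl⟩)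
    · exact hC (Or.inr ⟨x, rfl⟩)
  rw [eq_top_iff]
  intro r _
  obtain ⟨p, rfl⟩ := RingQuot.mkAlgHom_surjective K (QuivRel K σ s t rels) r
  have hp : p ∈ C.comap (proj K s t rels) := by
    rw [h]
    trivial
  exact hp

/-- The two-dimensional representation in which only the arrow `x` acts as a matrix unit. -/
def rep [DecidableEq σ] (K : Type) [Field K] (s t : σ → Fin 2) (x : σ) :
    FreeAlgebra K (TPGen σ) →ₐ[K] Matrix (Fin 2) (Fin 2) K :=
  FreeAlgebra.lift K fun
    | .v i => Matrix.single i i 1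
    | .ar y => if y = x then Matrix.single (s x) (t x) 1 else 0

theorem rep_vtx [DecidableEq σ] (x : σ) (i : Fin 2) :
    rep K s t x (vtx K i) = Matrix.single i i 1 := by
  rw [rep, vtx, FreeAlgebra.lift_ι_apply]

theorem rep_arr_self [DecidableEq σ] (x : σ) :
    rep K s t x (arr K x) = Matrix.single (s x) (t x) 1 := by
  rw [rep, arr, FreeAlgebra.lift_ι_apply]
  exact if_pos rfl

theorem rep_arr_of_ne [DecidableEq σ] {x y : σ} (h : y ≠ x) : rep K s t x (arr K y) = 0 := by
  rw [rep, arr, FreeAlgebra.lift_ι_apply]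
  exact if_neg h

theorem rep_eq [DecidableEq σ] {x : σ}
    (hx : ∀ p ∈ rels, rep K s t x p.1 = rep K s t x p.2)
    {p q : FreeAlgebra K (TPGen σ)} (h : QuivRel K σ s t rels p q) :
    rep K s t x p = rep K s t x q := by
  cases h with
  | idem i => simp [rep_vtx]
  | orth i j h => simp [rep_vtx, h]
  | vsum =>
    simp only [map_add, rep_vtx, map_one]
    ext i j
    fin_cases i <;> fin_cases j <;> simp
  | src y =>
    by_cases h : y = x
    · subst h
      simp [rep_vtx, rep_arr_self]
    · simp [rep_arr_of_ne h]
  | tgt y =>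
    by_cases h : y = x
    · subst h
      simp [rep_vtx, rep_arr_self]
    · simp [rep_arr_of_ne h]
  | rel p h => exact hx p h

/-- The vertex numbered by a Boolean. -/
def vert (j : Bool) : Fin 2 := bif j then 1 else 0

theorem vert_ne (j : Bool) : vert j ≠ vert (!j) := by cases j <;> decide

/-- A bound quiver algebra whose arrows are two opposite arrows and at most one loop at each
vertex, with the relations required for `TwoLoopData`. -/
def toTwoLoopData [DecidableEq σ] (a : Bool → BoundQuiverAlgebra K σ s t rels) (x : Bool → σ)
    (hs : ∀ j, s (x j) = vert (!j)) (ht : ∀ j, t (x j) = vert j)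
    (ha : ∀ j, a j = 0 ∨ ∃ y, a j = proj K s t rels (arr K y) ∧ s y = vert j ∧ t y = vert j)
    (hy : ∀ y, (∃ j, a j = proj K s t rels (arr K y)) ∨ ∃ j, x j = y)
    (ham : ∀ j, a (!j) * proj K s t rels (arr K (x j)) = 0)
    (hma : ∀ j, proj K s t rels (arr K (x j)) * a j = 0)
    (ha3 : ∀ j, a j ^ 3 = 0)
    (hm3 : ∀ j, (proj K s t rels (arr K (x (!j))) * proj K s t rels (arr K (x j))) ^ 3 = 0)
    (hrep : ∀ j, ∀ p ∈ rels, rep K s t (x j) p.1 = rep K s t (x j) p.2) :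
    TwoLoopData K (BoundQuiverAlgebra K σ s t rels) where
  e j := proj K s t rels (vtx K (vert j))
  a := a
  m j := proj K s t rels (arr K (x j))
  e_mul_e j := by rw [← map_mul, proj_eq (.idem _)]
  e_mul_not j := by rw [← map_mul, proj_eq (.orth _ _ (vert_ne j)), map_zero]
  e_add := by rw [← map_add, add_comm, ← map_one (proj K s t rels)]; exact proj_eq .vsum
  e_mul_a j := by
    rcases ha j with h | ⟨y, h, h1, -⟩
    · rw [h, mul_zero]
    · rw [h, ← h1, ← map_mul, proj_eq (.src _)]
  a_mul_e j := by
    rcases ha j with h | ⟨y, h, -, h1⟩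
    · rw [h, zero_mul]
    · rw [h, ← h1, ← map_mul, proj_eq (.tgt _)]
  e_mul_m j := by rw [← hs, ← map_mul, proj_eq (.src _)]
  m_mul_e j := by rw [← ht, ← map_mul, proj_eq (.tgt _)]
  a_mul_m := ham
  m_mul_a := hma
  a_cube := ha3
  m_cube := hm3
  generates C hC := by
    refine generates C ?_
    rintro _ (⟨i, rfl⟩ | ⟨y, rfl⟩)
    · refine hC (Or.inl (Or.inl ⟨i == 1, ?_⟩))
      fin_cases i <;> rfl
    · rcases hy y with ⟨j, hj⟩ | ⟨j, rfl⟩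
      · exact hC (Or.inl (Or.inr ⟨j, hj⟩))
      · exact hC (Or.inr ⟨j, rfl⟩)
  exists_hom j := by
    let φ : BoundQuiverAlgebra K σ s t rels →ₐ[K] Matrix (Fin 2) (Fin 2) K :=
      RingQuot.liftAlgHom K ⟨rep K s t (x j), fun {_ _} h => rep_eq (hrep j) h⟩
    have hφ (p) : φ (proj K s t rels p) = rep K s t (x j) p :=
      RingQuot.liftAlgHom_mkAlgHom_apply _ _ _ _
    refine ⟨_, inferInstance, inferInstance, φ, ?_, ?_, fun i => ?_⟩
    · rw [hφ, rep_arr_self]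
      intro h
      simpa using congrFun (congrFun h (s (x j))) (t (x j))
    · rw [hφ, rep_arr_of_ne]
      intro h
      exact vert_ne (!j) (by rw [← ht (!j), ← ht (!!j), h, Bool.not_not])
    · rcases ha i with h | ⟨y, h, h1, h2⟩
      · rw [h, map_zero]
      · rw [h, hφ, rep_arr_of_ne]
        rintro rfl
        exact vert_ne j (by rw [← ht, ← hs, h1, h2])

end BoundQuiver

open BoundQuiver

theorem cube_eq_zero {R : Type} [Ring R] {x y z : R} (hxy : x * y = 0) (hzx : z * x = 0)
    (h : x ^ 2 = (y * z) ^ 2) : x ^ 3 = 0 ∧ (y * z) ^ 3 = 0 ∧ (z * y) ^ 3 = 0 := by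
  refine ⟨?_, ?_, ?_⟩
  · rw [pow_succ', h, pow_two, mul_assoc y, ← mul_assoc x, hxy, zero_mul]
  · rw [pow_succ, ← h, pow_two, mul_assoc, ← mul_assoc x y, hxy, zero_mul, mul_zero]
  · have : (z * y) ^ 3 = z * (y * z) ^ 2 * y := by noncomm_ring
    rw [this, ← h, pow_two, ← mul_assoc, hzx, zero_mul, zero_mul]

/-- The algebra `D₂`. -/
def twoLoopDataD2 (K : Type) [Field K] : TwoLoopData K (HeckeD2 K) := by
  let q : FreeAlgebra K (TPGen (Fin 3)) →ₐ[K] HeckeD2 K := proj K _ _ _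
  have h1 : q (QD.al K) * q (QD.mu K) = 0 := by
    rw [← map_mul, ← map_zero q]
    exact proj_rel (by simp)
  have h2 : q (QD.nu K) * q (QD.al K) = 0 := by
    rw [← map_mul, ← map_zero q]
    exact proj_rel (by simp)
  have h3 : q (QD.al K) ^ 2 = (q (QD.mu K) * q (QD.nu K)) ^ 2 := by
    rw [← map_mul, ← map_pow, ← map_pow]
    exact proj_rel (by simp)
  have hcube := cube_eq_zero h1 h2 h3
  refine toTwoLoopData (fun j => bif j then 0 else q (QD.al K)) (fun j => bif j then 1 else 2)
    (by decide) (by decide) ?_ ?_ ?_ ?_ ?_ ?_ ?_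
  · rintro (_ | _)
    · exact Or.inr ⟨0, rfl, rfl, rfl⟩
    · exact Or.inl rfl
  · intro y
    fin_cases y
    · exact Or.inl ⟨false, rfl⟩
    · exact Or.inr ⟨true, rfl⟩
    · exact Or.inr ⟨false, rfl⟩
  · rintro (_ | _)
    · exact zero_mul _
    · exact h1
  · rintro (_ | _)
    · exact h2
    · exact mul_zero _
  · rintro (_ | _)
    · exact hcube.1
    · exact zero_pow (by decide)
  · rintro (_ | _)
    · exact hcube.2.1
    · exact hcube.2.2
  · rintro (_ | _) p (rfl | rfl | rfl) <;>
      simp [QD.al, QD.mu, QD.nu, rep_arr_of_ne]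

/-- An algebra with two loops and two opposite arrows. -/
def twoLoopDataQE {K : Type} [Field K]
    {rels : Set (FreeAlgebra K (TPGen (Fin 4)) × FreeAlgebra K (TPGen (Fin 4)))}
    (h1 : (QE.al K * QE.mu K, 0) ∈ rels) (h2 : (QE.mu K * QE.be K, 0) ∈ rels)
    (h3 : (QE.be K * QE.nu K, 0) ∈ rels) (h4 : (QE.nu K * QE.al K, 0) ∈ rels)
    {n : ℕ} (hn : n = 1 ∨ n = 2)
    (h5 : (QE.al K ^ 2, (QE.mu K * QE.nu K) ^ n) ∈ rels)
    (h6 : (QE.be K ^ 2, (QE.nu K * QE.mu K) ^ n) ∈ rels)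
    (hrep : ∀ j, ∀ p ∈ rels, rep K QE.s QE.t (bif j then 2 else 3) p.1 =
      rep K QE.s QE.t (bif j then 2 else 3) p.2) :
    TwoLoopData K (BoundQuiverAlgebra K (Fin 4) QE.s QE.t rels) := by
  let q : FreeAlgebra K (TPGen (Fin 4)) →ₐ[K] BoundQuiverAlgebra K (Fin 4) QE.s QE.t rels :=
    proj K _ _ _
  have h1 : q (QE.al K) * q (QE.mu K) = 0 := by
    rw [← map_mul, ← map_zero q]
    exact proj_rel h1
  have h2 : q (QE.mu K) * q (QE.be K) = 0 := by
    rw [← map_mul, ← map_zero q]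
    exact proj_rel h2
  have h3 : q (QE.be K) * q (QE.nu K) = 0 := by
    rw [← map_mul, ← map_zero q]
    exact proj_rel h3
  have h4 : q (QE.nu K) * q (QE.al K) = 0 := by
    rw [← map_mul, ← map_zero q]
    exact proj_rel h4
  have h5 : q (QE.al K) ^ 2 = (q (QE.mu K) * q (QE.nu K)) ^ n := by
    rw [← map_mul, ← map_pow, ← map_pow]
    exact proj_rel h5
  have h6 : q (QE.be K) ^ 2 = (q (QE.nu K) * q (QE.mu K)) ^ n := by
    rw [← map_mul, ← map_pow, ← map_pow]
    exact proj_rel h6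
  have hpow {x y z : BoundQuiverAlgebra K (Fin 4) QE.s QE.t rels} (hxy : x * y = 0)
      (hx : x ^ 2 = (y * z) ^ n) : x ^ 3 = 0 ∧ (y * z) ^ 3 = 0 := by
    obtain ⟨k, rfl⟩ : ∃ k, n = k + 1 := ⟨n - 1, by omega⟩
    refine ⟨?_, ?_⟩
    · rw [pow_succ', hx, pow_succ', ← mul_assoc, ← mul_assoc, hxy, zero_mul, zero_mul]
    · refine pow_eq_zero_of_le (show k + 1 + 1 ≤ 3 by omega) ?_
      rw [pow_succ, ← hx, pow_two, mul_assoc, ← mul_assoc x y, hxy, zero_mul, mul_zero]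
  refine toTwoLoopData (fun j => bif j then q (QE.be K) else q (QE.al K))
    (fun j => bif j then 2 else 3) (by decide) (by decide) ?_ ?_ ?_ ?_ ?_ ?_ hrep
  · rintro (_ | _)
    · exact Or.inr ⟨0, rfl, rfl, rfl⟩
    · exact Or.inr ⟨1, rfl, rfl, rfl⟩
  · intro y
    fin_cases y
    · exact Or.inl ⟨false, rfl⟩
    · exact Or.inl ⟨true, rfl⟩
    · exact Or.inr ⟨true, rfl⟩
    · exact Or.inr ⟨false, rfl⟩
  · rintro (_ | _)
    · exact h3
    · exact h1
  · rintro (_ | _)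
    · exact h4
    · exact h2
  · rintro (_ | _)
    · exact (hpow h1 h5).1
    · exact (hpow h3 h6).1
  · rintro (_ | _)
    · exact (hpow h1 h5).2
    · exact (hpow h3 h6).2

/-- The algebra `D₃`. -/
def twoLoopDataD3 (K : Type) [Field K] : TwoLoopData K (HeckeD3 K) := by
  refine twoLoopDataQE (n := 1) (by simp) (by simp) (by simp) (by simp) (Or.inl rfl) (by simp)
    (by simp) ?_
  rintro (_ | _) p (rfl | rfl | rfl | rfl | rfl | rfl) <;>
    simp [QE.al, QE.mu, QE.nu, QE.be, rep_arr_of_ne]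

/-- The algebra `D₄`. -/
def twoLoopDataD4 (K : Type) [Field K] : TwoLoopData K (HeckeD4 K) := by
  refine twoLoopDataQE (n := 2) (by simp) (by simp) (by simp) (by simp) (Or.inr rfl) (by simp)
    (by simp) ?_
  rintro (_ | _) p (rfl | rfl | rfl | rfl | rfl | rfl) <;>
    simp [QE.al, QE.mu, QE.nu, QE.be, rep_arr_of_ne]

/-- The words of length at least `n` in two commuting elements of square zero. -/
def localWords {R : Type} [Ring R] (a b : R) : ℕ → Set R
  | 0 => {1, a, b, a * b}
  | 1 => {a, b, a * b}
  | 2 => {a * b}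
  | _ => ∅

theorem localWords_succ_subset {R : Type} [Ring R] (a b : R) (n : ℕ) :
    localWords a b (n + 1) ⊆ localWords a b n := by
  rcases n with _ | _ | _ | n
  · exact fun x hx => Or.inr hx
  · exact fun x hx => Or.inr (Or.inr hx)
  · exact Set.empty_subset _
  · exact Set.empty_subset _

theorem mul_mem_span_localWords (K : Type) [Field K] {R : Type} [Ring R] [Algebra K R] {a b : R}
    (ha : a * a = 0) (hb : b * b = 0) (hab : a * b = b * a) (n : ℕ) {g w : R}
    (hg : g ∈ ({a, b} : Set R)) (hw : w ∈ localWords a b n) :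
    g * w ∈ Submodule.span K (localWords a b (n + 1)) ∧ w * g = g * w := by
  have h1 : a ∈ localWords a b 1 := Or.inl rfl
  have h2 : b ∈ localWords a b 1 := Or.inr (Or.inl rfl)
  have h3 : a * b ∈ localWords a b 2 := rfl
  have haab : a * (a * b) = 0 := by rw [← mul_assoc, ha, zero_mul]
  have hbab : b * (a * b) = 0 := by rw [hab, ← mul_assoc, hb, zero_mul]
  have haba : a * b * a = 0 := by rw [mul_assoc, ← hab, haab]
  have habb : a * b * b = 0 := by rw [mul_assoc, hb, mul_zero]
  rcases n with _ | _ | _ | n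
  · rcases hg with rfl | rfl <;> rcases hw with rfl | rfl | rfl | rfl
    · exact ⟨by rw [mul_one]; exact Submodule.subset_span h1, by rw [mul_one, one_mul]⟩
    · exact ⟨by rw [ha]; exact zero_mem _, rfl⟩
    · exact ⟨Submodule.subset_span (localWords_succ_subset _ _ _ h3), hab.symm⟩
    · exact ⟨by rw [haab]; exact zero_mem _, by rw [haab, haba]⟩
    · exact ⟨by rw [mul_one]; exact Submodule.subset_span h2, by rw [mul_one, one_mul]⟩
    · exact ⟨by rw [← hab]; exact Submodule.subset_span (localWords_succ_subset _ _ _ h3), hab⟩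
    · exact ⟨by rw [hb]; exact zero_mem _, rfl⟩
    · exact ⟨by rw [hbab]; exact zero_mem _, by rw [hbab, habb]⟩
  · rcases hg with rfl | rfl <;> rcases hw with rfl | rfl | rfl
    · exact ⟨by rw [ha]; exact zero_mem _, rfl⟩
    · exact ⟨Submodule.subset_span h3, hab.symm⟩
    · exact ⟨by rw [haab]; exact zero_mem _, by rw [haab, haba]⟩
    · exact ⟨by rw [← hab]; exact Submodule.subset_span h3, hab⟩
    · exact ⟨by rw [hb]; exact zero_mem _, rfl⟩
    · exact ⟨by rw [hbab]; exact zero_mem _, by rw [hbab, habb]⟩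
  · rcases hg with rfl | rfl <;> rcases hw with rfl
    · exact ⟨by rw [haab]; exact zero_mem _, by rw [haab, haba]⟩
    · exact ⟨by rw [hbab]; exact zero_mem _, by rw [hbab, habb]⟩
  · exact hw.elim

/-- A local algebra generated by two commuting elements of square zero, as basic data. -/
def localBasicData {K : Type} [Field K] {R : Type} [Ring R] [Algebra K R] {a b : R}
    (ha : a * a = 0) (hb : b * b = 0) (hab : a * b = b * a) (hgen : Generates K {a, b})
    (h1 : (1 : R) ≠ 0) : BasicData K Unit R := by
  let W : ℕ → Set R := localWords a b
  have mem {n : ℕ} {x : R} (h : x ∈ W n) : x ∈ Submodule.span K (W n) := Submodule.subset_span h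
  have one_mem : (1 : R) ∈ W 0 := Or.inl rfl
  have anti (n : ℕ) : Submodule.span K (W (n + 1)) ≤ Submodule.span K (W n) :=
    Submodule.span_mono (localWords_succ_subset a b n)
  have step (n : ℕ) (g) (hg : g ∈ ({a, b} : Set R)) (w) (hw : w ∈ W n) :
      g * w ∈ Submodule.span K (W (n + 1)) ∧ w * g ∈ Submodule.span K (W (n + 1)) := by
    have := mul_mem_span_localWords K ha hb hab n hg hw
    exact ⟨this.1, this.2 ▸ this.1⟩
  have left (n : ℕ) (r x : R) (hx : x ∈ Submodule.span K (W n)) :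
      r * x ∈ Submodule.span K (W n) :=
    hgen.mul_mem_left (fun g hg w hw => anti n (step n g hg w hw).1) r hx
  have right (n : ℕ) (r x : R) (hx : x ∈ Submodule.span K (W n)) :
      x * r ∈ Submodule.span K (W n) :=
    hgen.mul_mem_right (fun g hg w hw => anti n (step n g hg w hw).2) r hx
  have smul_mem_one (w : R) (hw : w ∈ W 1) (n : ℕ) (y : R)
      (hy : y ∈ Submodule.span K (W n)) : w * y ∈ Submodule.span K (W (n + 1)) := by
    have gen (g) (hg : g ∈ ({a, b} : Set R)) (y : R) (hy : y ∈ Submodule.span K (W n)) :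
        g * y ∈ Submodule.span K (W (n + 1)) := by
      induction hy using Submodule.span_induction with
      | mem y hy => exact (step n g hg y hy).1
      | zero => rw [mul_zero]; exact zero_mem _
      | add x y _ _ hx hy => rw [mul_add]; exact add_mem hx hy
      | smul c x _ hx => rw [mul_smul_comm]; exact Submodule.smul_mem _ _ hx
    rcases hw with rfl | rfl | rfl
    · exact gen _ (by simp) y hy
    · exact gen _ (by simp) y hy
    · rw [mul_assoc]
      exact gen _ (by simp) _ (left n _ _ hy)
  have residue (r : R) : ∃ c : K, r - c • (1 : R) ∈ Submodule.span K (W 1) := by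
    have hr : r ∈ Submodule.span K (W 0) := by
      have := left 0 r 1 (mem one_mem)
      rwa [mul_one] at this
    induction hr using Submodule.span_induction with
    | mem x hx =>
      rcases hx with rfl | hx
      · exact ⟨1, by simp⟩
      · exact ⟨0, by simpa using mem (n := 1) hx⟩
    | zero => exact ⟨0, by simp⟩
    | add x y _ _ hx hy =>
      obtain ⟨c, hc⟩ := hx
      obtain ⟨d, hd⟩ := hy
      exact ⟨c + d, by simpa only [add_smul, add_sub_add_comm] using add_mem hc hd⟩
    | smul t x _ hx =>
      obtain ⟨c, hc⟩ := hx
      exact ⟨t * c, by simpa only [smul_sub, mul_smul] using Submodule.smul_mem _ t hc⟩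
  exact
    { e := fun _ => 1
      J := spanIdeal K (W 1) (left 1)
      mul_mem_right := fun x hx r => right 1 r x hx
      filt := fun n => spanIdeal K (W n) (left n)
      filt_zero := by
        rw [Ideal.eq_top_iff_one]
        exact mem one_mem
      mul_filt := fun n => by
        rw [Ideal.mul_le]
        intro x hx y hy
        change x ∈ Submodule.span K (W 1) at hx
        change x * y ∈ Submodule.span K (W (n + 1))
        induction hx using Submodule.span_induction with
        | mem x hx => exact smul_mem_one x hx n y hy
        | zero => rw [zero_mul]; exact zero_mem _
        | add x x' _ _ hx hx' => rw [add_mul]; exact add_mem hx hx'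
        | smul c x _ hx => rw [smul_mul_assoc]; exact Submodule.smul_mem _ _ hx
      filt_bot := ⟨3, by
        rw [eq_bot_iff]
        intro x hx
        change x ∈ Submodule.span K ∅ at hx
        rwa [Submodule.span_empty] at hx⟩
      mul_self := fun _ => mul_one 1
      mul_ne := fun v w h => absurd (Subsingleton.elim v w) h
      sum_e := by simp
      e_ne := fun _ => h1
      residue := fun _ r => by
        obtain ⟨c, hc⟩ := residue r
        exact ⟨c, by rwa [one_mul], by rwa [mul_one]⟩ }

/-- The algebra `D₁`. -/
def basicDataD1 (K : Type) [Field K] : BasicData K Unit (HeckeD1 K)ᵐᵒᵖ := by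
  let q : FreeAlgebra K (Fin 2) →ₐ[K] HeckeD1 K := RingQuot.mkAlgHom K (D1Rel K)
  have hq {x y} (h : D1Rel K x y) : q x = q y := RingQuot.mkAlgHom_rel K h
  let a := q (FreeAlgebra.ι K 0)
  let b := q (FreeAlgebra.ι K 1)
  have ha : a * a = 0 := by rw [← map_mul, hq .asq, map_zero]
  have hb : b * b = 0 := by rw [← map_mul, hq .bsq, map_zero]
  have hab : a * b = b * a := by rw [← map_mul, hq .comm, map_mul]
  have hgen : Generates K {a, b} := by
    intro C hC
    have h : C.comap q = ⊤ := by
      rw [eq_top_iff, ← FreeAlgebra.adjoin_range_ι, Algebra.adjoin_le_iff]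
      rintro _ ⟨i, rfl⟩
      fin_cases i
      · exact hC (Or.inl rfl)
      · exact hC (Or.inr rfl)
    rw [eq_top_iff]
    intro r _
    obtain ⟨p, rfl⟩ := RingQuot.mkAlgHom_surjective K (D1Rel K) r
    have hp : p ∈ C.comap q := by
      rw [h]
      trivial
    exact hp
  let φ : HeckeD1 K →ₐ[K] K := RingQuot.liftAlgHom K ⟨FreeAlgebra.lift K 0, by
    rintro _ _ (_ | _ | _) <;> simp⟩
  have h1 : (1 : HeckeD1 K) ≠ 0 := fun h => one_ne_zero (α := K) (by
    rw [← map_one φ, h, map_zero])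
  refine localBasicData (a := .op a) (b := .op b) (congrArg MulOpposite.op ha)
    (congrArg MulOpposite.op hb) (congrArg MulOpposite.op hab.symm) (fun C hC => ?_)
    fun h => h1 (MulOpposite.op_injective h)
  refine hgen.op C fun x hx => hC ?_
  rcases hx with h | h
  · exact Or.inl (congrArg MulOpposite.op h)
  · exact Or.inr (congrArg MulOpposite.op h)

/-- The algebra `D₂`, acting on right modules. -/
def twoVertexD2 (K : Type) [Field K] : TwoVertex K (HeckeD2 K)ᵐᵒᵖ :=
  (twoLoopDataD2 K).op.toTwoVertex

/-- The algebra `D₃`, acting on right modules. -/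
def twoVertexD3 (K : Type) [Field K] : TwoVertex K (HeckeD3 K)ᵐᵒᵖ :=
  (twoLoopDataD3 K).op.toTwoVertex

/-- The algebra `D₄`, acting on right modules. -/
def twoVertexD4 (K : Type) [Field K] : TwoVertex K (HeckeD4 K)ᵐᵒᵖ :=
  (twoLoopDataD4 K).op.toTwoVertex

theorem TwoVertex.isTauTiltingFinite_of_moritaEquivalent {K : Type} [Field K] {Λ D : Type}
    [Ring Λ] [Ring D] [Algebra K Dᵐᵒᵖ] (T : TwoVertex K Dᵐᵒᵖ) (h : MoritaEquivalent Λ D) :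
    IsTauTiltingFinite Λ :=
  h.isTauTiltingFinite (Q := T.Qq) fun _ _ _ _ hind hN => T.exists_equiv_Qq hind hN

theorem BasicData.isTauTiltingFinite_of_moritaEquivalent {K : Type} [Field K] {Λ D : Type}
    [Ring Λ] [Ring D] [Algebra K Dᵐᵒᵖ] (B : BasicData K Unit Dᵐᵒᵖ) (h : MoritaEquivalent Λ D) :
    IsTauTiltingFinite Λ :=
  h.isTauTiltingFinite (Q := fun _ : Unit => B.Q () ⊥) fun _ _ _ _ hind hN =>
    ⟨(), B.exists_equiv_of_local hind hN⟩

/-- Theorem 5.6.  Over an algebraically closed field of characteristic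
`≠ 2`, the algebras `D₁, …, D₄` are τ-tilting finite: `D₁` has exactly `2` basic support
τ-tilting modules, and `D₂, D₃, D₄` each have exactly `6`, with Hasse quiver of type
`H_{2,2}`.  Consequently every finite dimensional algebra Morita equivalent to one of
`D₁, …, D₄` (in particular every representation-infinite tame block of a Hecke algebra of
classical type, by Ariki's classification) is τ-tilting finite. -/
theorem tame_hecke_blocks_tau_tilting_finite (K : Type) [Field K] [IsAlgClosed K]
    (hchar : ringChar K ≠ 2) :
    IsTauTiltingFinite (HeckeD1 K) ∧ SupportTauTiltingCount (HeckeD1 K) 2 ∧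
    TauTiltingData (HeckeD2 K) 6 2 2 ∧
    TauTiltingData (HeckeD3 K) 6 2 2 ∧
    TauTiltingData (HeckeD4 K) 6 2 2 ∧
    (∀ (Λ : Type) [Ring Λ] [Algebra K Λ], FiniteDimensional K Λ →
      (MoritaEquivalent Λ (HeckeD1 K) ∨ MoritaEquivalent Λ (HeckeD2 K) ∨
       MoritaEquivalent Λ (HeckeD3 K) ∨ MoritaEquivalent Λ (HeckeD4 K)) →
      IsTauTiltingFinite Λ) := by
  refine ⟨(basicDataD1 K).isTauTiltingFinite_of_local,
    (basicDataD1 K).supportTauTiltingCount_of_local,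
    (twoVertexD2 K).tauTiltingData, (twoVertexD3 K).tauTiltingData,
    (twoVertexD4 K).tauTiltingData, fun Λ _ _ _ h => ?_⟩
  rcases h with h | h | h | h
  · exact (basicDataD1 K).isTauTiltingFinite_of_moritaEquivalent h
  · exact (twoVertexD2 K).isTauTiltingFinite_of_moritaEquivalent h
  · exact (twoVertexD3 K).isTauTiltingFinite_of_moritaEquivalent h
  · exact (twoVertexD4 K).isTauTiltingFinite_of_moritaEquivalent h

end TwoPoint
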